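/- arXiv:1410.8189 — 2 statements merged into one kernel-verified Lean document; each statement's English description precedes it below -/
import Mathlib

section
/- For every ε > 0 there exists y₀ ≥ 2 such that the following holds for all y ≥ y₀. Let χ be a Dirichlet character modulo q, and let ξ be a primitive Dirichlet character of conductor D ≤ log y satisfying 𝔻(χ, ξ; y) ≤ 𝔻(χ, ψ₁; y) for every primitive Dirichlet character ψ₁ of conductor at most log y. Then for every Dirichlet character ψ modulo d with d ≤ y whose conductor is at most log y and which is not induced by ξ (i.e. ψ is not the character modulo d obtained by lifting ξ to modulus d when D ∣ d), and for every real z ≥ 1, one has |∑_{n ≤ z, P⁺(n) ≤ y} χ(n)·conj(ψ)(n)/n| ≤ (log y)^{1/2 + √2/4 + ε}. -/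
open Real Complex MeasureTheory
open scoped BigOperators

attribute [local instance] Classical.propDecidable

/-- `e(x) = exp(2πix)` -/
noncomputable def e2pi (x : ℝ) : ℂ := Complex.exp (2 * Real.pi * Complex.I * x)

/-- `∑_{n ≤ x} χ(n)` -/
noncomputable def charSum {q : ℕ} (χ : DirichletCharacter ℂ q) (x : ℝ) : ℂ :=
  ∑ n ∈ Finset.Icc 1 ⌊x⌋₊, χ (n : ZMod q)

/-- `M(χ) = max_{1 ≤ N ≤ q} |∑_{n ≤ N} χ(n)|` -/
noncomputable def Mchi {q : ℕ} (χ : DirichletCharacter ℂ q) : ℝ :=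
  ⨆ N ∈ Finset.Icc 1 q, ‖charSum χ (N : ℝ)‖

/-- `m(χ) = π M(χ)/(e^γ √q)` -/
noncomputable def mchi {q : ℕ} (χ : DirichletCharacter ℂ q) : ℝ :=
  Real.pi * Mchi χ / (Real.exp Real.eulerMascheroniConstant * Real.sqrt q)

/-- the modified Bessel function `I₀` -/
noncomputable def I0 (t : ℝ) : ℝ := ∑' n : ℕ, (t ^ 2 / 4) ^ n / ((n.factorial : ℝ)) ^ 2

/-- the constant `A` -/
noncomputable def Aconst : ℝ :=
  Real.log 2 - 1 - (∫ t in (0:ℝ)..2, Real.log (I0 t) / t ^ 2)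
    - ∫ t in Set.Ioi (2:ℝ), (Real.log (I0 t) - t) / t ^ 2

/-- `Φ_q(τ)` -/
noncomputable def Phi (q : ℕ) (τ : ℝ) : ℝ :=
  (Nat.card {χ : DirichletCharacter ℂ q // χ ≠ 1 ∧ τ < mchi χ} : ℝ) / q.totient

/-- `S_𝒜(χ) = max_{α ∈ [0,1]} |∑_{n ∈ 𝒜} χ(n) e(nα)/n|` -/
noncomputable def SA {q : ℕ} (χ : DirichletCharacter ℂ q) (A : Finset ℕ) : ℝ :=
  ⨆ α : Set.Icc (0:ℝ) 1, ‖∑ n ∈ A, χ (n : ZMod q) * e2pi (n * (α : ℝ)) / n‖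

/-- `S_{y,z}(χ)` -/
noncomputable def Syz {q : ℕ} (χ : DirichletCharacter ℂ q) (y z : ℝ) : ℝ :=
  SA χ ((Finset.Icc 1 ⌊z⌋₊).filter fun n => ∃ p : ℕ, p.Prime ∧ p ∣ n ∧ y < (p : ℝ))

/-- `L(1,χ)` -/
noncomputable def Lone {q : ℕ} (χ : DirichletCharacter ℂ q) : ℂ :=
  ∑' n : ℕ, χ (n : ZMod q) / n

/-- the Gauss sum `G(χ) = ∑_{a=1}^{q} χ(a) e(a/q)` -/
noncomputable def gaussS {q : ℕ} (χ : DirichletCharacter ℂ q) : ℂ :=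
  ∑ a ∈ Finset.Icc 1 q, χ (a : ZMod q) * e2pi ((a : ℝ) / q)

/-- the pretentious distance `𝔻(χ, ξ; y)` -/
noncomputable def Ddist {q D : ℕ} (χ : DirichletCharacter ℂ q) (ξ : DirichletCharacter ℂ D)
    (y : ℝ) : ℝ :=
  Real.sqrt (∑ p ∈ (Finset.Icc 1 ⌊y⌋₊).filter Nat.Prime,
    (1 - (χ (p : ZMod q) * (starRingEnd ℂ) (ξ (p : ZMod D))).re) / p)

section HalberstamRichert

open ArithmeticFunction
open scoped ArithmeticFunction.zeta

/-- The arithmetic function underlying a monoid homomorphism `ℕ →*₀ ℂ`. -/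
noncomputable def homArith (F : ℕ →*₀ ℂ) : ArithmeticFunction ℂ := ⟨F, map_zero F⟩

/-- The von Mangoldt function with complex values. -/
noncomputable def vonMangoldtC : ArithmeticFunction ℂ := ⟨fun n => ((vonMangoldt n : ℝ) : ℂ), by simp⟩

/-- The logarithm as a complex-valued arithmetic function. -/
noncomputable def logC : ArithmeticFunction ℂ := ⟨fun n => ((Real.log n : ℝ) : ℂ), by simp⟩

/-- The divisor sum `∑_{d ∣ n} F(d)`. -/
noncomputable def divSum (F : ℕ →*₀ ℂ) : ArithmeticFunction ℂ := homArith F * (ζ : ArithmeticFunction ℂ)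

lemma zeta_mul_vonMangoldtC : (ζ : ArithmeticFunction ℂ) * vonMangoldtC = logC := by
  ext n
  rw [coe_zeta_mul_apply]
  simp only [vonMangoldtC, logC, coe_mk]
  rw [← Complex.ofReal_sum, vonMangoldt_sum]

/-- Pointwise multiplication by the logarithm is a derivation. -/
lemma pmul_logC_mul (f g : ArithmeticFunction ℂ) :
    logC.pmul (f * g) = logC.pmul f * g + f * logC.pmul g := by
  ext n
  simp only [pmul_apply, mul_apply, ArithmeticFunction.add_apply, Finset.mul_sum, ← Finset.sum_add_distrib]
  refine Finset.sum_congr rfl fun x hx => ?_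
  have h := Nat.mem_divisorsAntidiagonal.1 hx
  have h1 : x.1 ≠ 0 := by rintro h0; simp [h0] at h; exact h.2 h.1.symm
  have h2 : x.2 ≠ 0 := by rintro h0; simp [h0] at h; exact h.2 h.1.symm
  have : (logC n : ℂ) = logC x.1 + logC x.2 := by
    simp only [logC, coe_mk]
    rw [← h.1, Nat.cast_mul, Real.log_mul (by exact_mod_cast h1) (by exact_mod_cast h2)]
    push_cast; rfl
  rw [this]; ring

lemma homArith_pmul_mul (F : ℕ →*₀ ℂ) (f g : ArithmeticFunction ℂ) :
    (homArith F).pmul (f * g) = (homArith F).pmul f * (homArith F).pmul g := by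
  ext n
  simp only [pmul_apply, mul_apply, Finset.mul_sum]
  refine Finset.sum_congr rfl fun x hx => ?_
  have h := (Nat.mem_divisorsAntidiagonal.1 hx).1
  have : homArith F n = homArith F x.1 * homArith F x.2 := by
    simp [homArith, ← h]
  rw [this]; ring

lemma logC_pmul_homArith (F : ℕ →*₀ ℂ) :
    logC.pmul (homArith F) = homArith F * (homArith F).pmul vonMangoldtC := by
  have h := homArith_pmul_mul F (ζ : ArithmeticFunction ℂ) vonMangoldtC
  rw [zeta_mul_vonMangoldtC, pmul_zeta] at h
  rw [pmul_comm, h]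

lemma logC_pmul_divSum (F : ℕ →*₀ ℂ) :
    logC.pmul (divSum F) = divSum F * (vonMangoldtC + (homArith F).pmul vonMangoldtC) := by
  rw [divSum, pmul_logC_mul, logC_pmul_homArith]
  have : logC.pmul (ζ : ArithmeticFunction ℂ) = ζ * vonMangoldtC := by
    rw [pmul_zeta, zeta_mul_vonMangoldtC]
  rw [this]; ring

lemma norm_divSum_mul_log_le {F : ℕ →*₀ ℂ} (hF : ∀ n, ‖F n‖ ≤ 1) (n : ℕ) :
    ‖divSum F n‖ * Real.log n ≤ ∑ x ∈ n.divisorsAntidiagonal, ‖divSum F x.1‖ * (2 * vonMangoldt x.2) := by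
  have h := congrArg (fun f => ‖f n‖) (logC_pmul_divSum F)
  simp only [pmul_apply, mul_apply, norm_mul] at h
  have hl : ‖logC n‖ = Real.log n := by
    simp only [logC, coe_mk]
    rw [Complex.norm_real, Real.norm_of_nonneg (Real.log_natCast_nonneg n)]
  rw [hl, mul_comm] at h
  rw [h]
  refine (norm_sum_le _ _).trans (Finset.sum_le_sum fun x _ => ?_)
  rw [norm_mul]
  refine mul_le_mul_of_nonneg_left ?_ (norm_nonneg (divSum F _))
  have hv : ‖vonMangoldtC x.2‖ = vonMangoldt x.2 := by
    simp only [vonMangoldtC, coe_mk]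
    rw [Complex.norm_real, Real.norm_of_nonneg vonMangoldt_nonneg]
  have hFx : ‖homArith F x.2‖ ≤ 1 := hF x.2
  calc ‖(vonMangoldtC + (homArith F).pmul vonMangoldtC) x.2‖
      ≤ ‖vonMangoldtC x.2‖ + ‖homArith F x.2 * vonMangoldtC x.2‖ := by
        rw [ArithmeticFunction.add_apply, pmul_apply]; exact norm_add_le _ _
    _ ≤ vonMangoldt x.2 + 1 * vonMangoldt x.2 := by
        rw [norm_mul, hv]
        gcongr
    _ = _ := by ring

lemma sum_norm_divSum_mul_log_le {F : ℕ →*₀ ℂ} (hF : ∀ n, ‖F n‖ ≤ 1) (N : ℕ) :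
    ∑ n ∈ Finset.Ioc 0 N, ‖divSum F n‖ * Real.log n ≤
      2 * (Real.log 4 + 4) * N * ∑ n ∈ Finset.Ioc 0 N, ‖divSum F n‖ / n := by
  let g : ArithmeticFunction ℝ := ⟨fun n => ‖divSum F n‖, by simp⟩
  let v : ArithmeticFunction ℝ := ⟨fun n => 2 * vonMangoldt n, by simp⟩
  calc ∑ n ∈ Finset.Ioc 0 N, ‖divSum F n‖ * Real.log n
      ≤ ∑ n ∈ Finset.Ioc 0 N, (g * v) n :=
        Finset.sum_le_sum fun n _ => by
          rw [mul_apply]; exact norm_divSum_mul_log_le hF n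
    _ = ∑ n ∈ Finset.Ioc 0 N, g n * ∑ m ∈ Finset.Ioc 0 (N / n), v m :=
        sum_Ioc_mul_eq_sum_sum g v N
    _ ≤ ∑ n ∈ Finset.Ioc 0 N, g n * (2 * ((Real.log 4 + 4) * (N / n))) := by
        refine Finset.sum_le_sum fun n _ => mul_le_mul_of_nonneg_left ?_ (norm_nonneg (divSum F n))
        change ∑ m ∈ Finset.Ioc 0 (N / n), 2 * vonMangoldt m ≤ _
        rw [← Finset.mul_sum]
        have h := Chebyshev.psi_le_const_mul_self (x := (N : ℝ) / n) (by positivity)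
        rw [Chebyshev.psi, Nat.floor_div_natCast, Nat.floor_natCast] at h
        linarith
    _ = _ := by
        rw [Finset.mul_sum]
        exact Finset.sum_congr rfl fun n _ => by change ‖divSum F n‖ * _ = _; ring

lemma sum_norm_divSum_mul_log_le' {F : ℕ →*₀ ℂ} (hF : ∀ n, ‖F n‖ ≤ 1) (N : ℕ) :
    (∑ n ∈ Finset.Ioc 0 N, ‖divSum F n‖) * Real.log N ≤
      (2 * (Real.log 4 + 4) + 1) * N * ∑ n ∈ Finset.Ioc 0 N, ‖divSum F n‖ / n := by
  have h1 := sum_norm_divSum_mul_log_le hF N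
  have h2 : ∑ n ∈ Finset.Ioc 0 N, ‖divSum F n‖ * (Real.log N - Real.log n) ≤
      N * ∑ n ∈ Finset.Ioc 0 N, ‖divSum F n‖ / n := by
    rw [Finset.mul_sum]
    refine Finset.sum_le_sum fun n hn => ?_
    obtain ⟨h0, hN⟩ := Finset.mem_Ioc.1 hn
    have hn0 : (0 : ℝ) < n := by exact_mod_cast h0
    have hN0 : (0 : ℝ) < N := by exact_mod_cast h0.trans_le hN
    rw [← Real.log_div hN0.ne' hn0.ne']
    have := Real.log_le_sub_one_of_pos (div_pos hN0 hn0)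
    calc _ ≤ ‖divSum F n‖ * (N / n) := by gcongr; linarith
      _ = _ := by ring
  calc _ = ∑ n ∈ Finset.Ioc 0 N, ‖divSum F n‖ * (Real.log N - Real.log n) +
        ∑ n ∈ Finset.Ioc 0 N, ‖divSum F n‖ * Real.log n := by
        rw [← Finset.sum_add_distrib, Finset.sum_mul]
        exact Finset.sum_congr rfl fun n _ => by ring
    _ ≤ _ := by linarith

lemma norm_sum_div_le {F : ℕ →*₀ ℂ} (hF : ∀ n, ‖F n‖ ≤ 1) {N : ℕ} (hN : 0 < N) :
    N * ‖∑ n ∈ Finset.Ioc 0 N, F n / n‖ ≤ N + ∑ n ∈ Finset.Ioc 0 N, ‖divSum F n‖ := by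
  have h := sum_Ioc_mul_zeta_eq_sum (homArith F) N
  have hN' : (N : ℝ) = ‖(N : ℂ)‖ := by simp
  have key : (N : ℂ) * ∑ n ∈ Finset.Ioc 0 N, F n / n =
      ∑ n ∈ Finset.Ioc 0 N, F n * ((N : ℂ) / n - ((N / n : ℕ) : ℂ)) +
        ∑ n ∈ Finset.Ioc 0 N, divSum F n := by
    rw [divSum, h, Finset.mul_sum, ← Finset.sum_add_distrib]
    exact Finset.sum_congr rfl fun n _ => by simp only [homArith, coe_mk]; ring
  rw [hN', ← norm_mul, key, ← hN']
  refine (norm_add_le _ _).trans (add_le_add ?_ (norm_sum_le _ _))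
  refine (norm_sum_le _ _).trans ?_
  calc _ ≤ ∑ n ∈ Finset.Ioc 0 N, (1 : ℝ) := Finset.sum_le_sum fun n hn => ?_
    _ = N := by simp
  rw [norm_mul]
  refine mul_le_one₀ (hF n) (norm_nonneg _) ?_
  have hn0 : (0 : ℝ) < n := by exact_mod_cast (Finset.mem_Ioc.1 hn).1
  have e : ((N : ℂ) / n - ((N / n : ℕ) : ℂ)) = (((N : ℝ) / n - ((N / n : ℕ) : ℝ) : ℝ) : ℂ) := by
    push_cast; rfl
  rw [e, Complex.norm_real, Real.norm_eq_abs, abs_le]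
  have h1 := Nat.floor_le (a := (N : ℝ) / n) (by positivity)
  have h2 := Nat.lt_floor_add_one ((N : ℝ) / n)
  rw [Nat.floor_div_natCast, Nat.floor_natCast] at h1 h2
  constructor <;> linarith

lemma homArith_isMultiplicative (F : ℕ →*₀ ℂ) : (homArith F).IsMultiplicative :=
  ⟨by simp [homArith], fun _ => by simp [homArith]⟩

lemma divSum_isMultiplicative (F : ℕ →*₀ ℂ) : (divSum F).IsMultiplicative :=
  (homArith_isMultiplicative F).mul isMultiplicative_zeta.natCast

lemma divSum_prime_pow (F : ℕ →*₀ ℂ) {p : ℕ} (hp : p.Prime) (k : ℕ) :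
    divSum F (p ^ k) = ∑ i ∈ Finset.range (k + 1), F p ^ i := by
  rw [divSum, coe_mul_zeta_apply, Nat.sum_divisors_prime_pow hp]
  exact Finset.sum_congr rfl fun i _ => by simp [homArith]

lemma norm_divSum_prime_pow_le {F : ℕ →*₀ ℂ} (hF : ∀ n, ‖F n‖ ≤ 1) {p : ℕ} (hp : p.Prime) (k : ℕ) :
    ‖divSum F (p ^ k)‖ ≤ k + 1 := by
  rw [divSum_prime_pow F hp]
  refine (norm_sum_le _ _).trans ?_
  calc _ ≤ ∑ i ∈ Finset.range (k + 1), (1 : ℝ) := Finset.sum_le_sum fun i _ => by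
        rw [norm_pow]; exact pow_le_one₀ (norm_nonneg _) (hF p)
    _ = _ := by simp

lemma sum_one_div_sq_le_two (s : Finset ℕ) : ∑ n ∈ s, 1 / (n : ℝ) ^ 2 ≤ 2 := by
  have h := hasSum_zeta_two
  refine (sum_le_hasSum s (fun _ _ => by positivity) h).trans ?_
  nlinarith [Real.pi_lt_d2, Real.pi_pos]

/-- The local Euler factor of `‖divSum F n‖ / n`. -/
lemma summable_and_tsum_divSum_prime_pow_le {F : ℕ →*₀ ℂ} (hF : ∀ n, ‖F n‖ ≤ 1) {p : ℕ}
    (hp : p.Prime) :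
    Summable (fun k : ℕ => ‖divSum F (p ^ k)‖ / ((p ^ k : ℕ) : ℝ)) ∧
      ∑' k : ℕ, ‖divSum F (p ^ k)‖ / ((p ^ k : ℕ) : ℝ) ≤
        Real.exp (‖1 + F p‖ / p + 8 * (1 / (p : ℝ) ^ 2)) := by
  set x : ℝ := (p : ℝ)⁻¹ with hx
  have hp2 : (2 : ℝ) ≤ p := by exact_mod_cast hp.two_le
  have hx0 : 0 < x := by positivity
  have hx2 : x ≤ 1 / 2 := by
    rw [hx, inv_le_comm₀ (by positivity) (by norm_num)]; norm_num; exact hp.two_le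
  have hx1 : ‖x‖ < 1 := by rw [Real.norm_of_nonneg hx0.le]; linarith
  have hbd (k : ℕ) : ‖divSum F (p ^ k)‖ / ((p ^ k : ℕ) : ℝ) ≤ k * x ^ k + x ^ k := by
    have h := norm_divSum_prime_pow_le hF hp k
    rw [Nat.cast_pow, div_eq_mul_inv, ← inv_pow]
    calc _ ≤ (k + 1) * x ^ k := by gcongr
      _ = _ := by ring
  have hs0 : Summable (fun k : ℕ => (k : ℝ) * x ^ k) :=
    (hasSum_coe_mul_geometric_of_norm_lt_one hx1).summable
  have hs1 : Summable (fun k : ℕ => x ^ k) := summable_geometric_of_norm_lt_one hx1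
  have hs : Summable (fun k : ℕ => ‖divSum F (p ^ k)‖ / ((p ^ k : ℕ) : ℝ)) :=
    Summable.of_nonneg_of_le (fun k => by positivity) hbd (hs0.add hs1)
  refine ⟨hs, ?_⟩
  have htail : ∑' k : ℕ, ‖divSum F (p ^ (k + 2))‖ / ((p ^ (k + 2) : ℕ) : ℝ) ≤ 8 * x ^ 2 := by
    have hb (k : ℕ) : ‖divSum F (p ^ (k + 2))‖ / ((p ^ (k + 2) : ℕ) : ℝ) ≤
        x ^ 2 * (k * x ^ k + 3 * x ^ k) := by
      refine (hbd (k + 2)).trans (le_of_eq ?_)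
      push_cast; ring
    have hs3 := (hs0.hasSum.add (hs1.hasSum.mul_left 3)).mul_left (x ^ 2)
    have hle := hasSum_le hb ((summable_nat_add_iff 2).2 hs).hasSum hs3
    refine hle.trans ?_
    rw [tsum_coe_mul_geometric_of_norm_lt_one hx1, tsum_geometric_of_norm_lt_one hx1]
    have h1 : (1 - x)⁻¹ ≤ 2 := by
      rw [inv_le_comm₀ (by linarith) (by norm_num)]; norm_num; linarith
    have h2 : x / (1 - x) ^ 2 ≤ 2 := by
      rw [div_le_iff₀ (by nlinarith)]; nlinarith
    nlinarith [sq_nonneg x]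
  have hone : ‖divSum F (p ^ 1)‖ = ‖1 + F p‖ := by
    rw [divSum_prime_pow F hp]; simp [Finset.sum_range_succ]
  rw [← hs.sum_add_tsum_nat_add 2, Finset.sum_range_succ, Finset.sum_range_one, hone]
  have hzero : ‖divSum F (p ^ 0)‖ = 1 := by rw [divSum_prime_pow F hp]; simp
  rw [hzero]
  have hx2' : 8 * (1 / (p : ℝ) ^ 2) = 8 * x ^ 2 := by rw [hx]; field_simp
  rw [hx2']
  have := Real.add_one_le_exp (‖1 + F p‖ / p + 8 * x ^ 2)
  simp only [pow_zero, Nat.cast_one, div_one, pow_one]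
  linarith

lemma sum_norm_divSum_div_le {F : ℕ →*₀ ℂ} (hF : ∀ n, ‖F n‖ ≤ 1) (N : ℕ) :
    ∑ n ∈ Finset.Ioc 0 N, ‖divSum F n‖ / n ≤
      Real.exp (∑ p ∈ (Finset.Icc 1 N).filter Nat.Prime, ‖1 + F p‖ / p + 16) := by
  let f : ℕ → ℝ := fun n => ‖divSum F n‖ / n
  have hmult := divSum_isMultiplicative F
  have h1 : f 1 = 1 := by simp [f, hmult.1]
  have hmul {m n : ℕ} (h : m.Coprime n) : f (m * n) = f m * f n := by
    simp only [f, hmult.2 h, norm_mul, Nat.cast_mul]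
    rw [mul_div_mul_comm]
  have hf0 (n : ℕ) : 0 ≤ f n := by positivity
  have hsum {p : ℕ} (hp : p.Prime) : Summable (fun k : ℕ => ‖f (p ^ k)‖) := by
    simp only [Real.norm_of_nonneg (hf0 _)]
    exact (summable_and_tsum_divSum_prime_pow_le hF hp).1
  obtain ⟨-, hS⟩ := EulerProduct.summable_and_hasSum_smoothNumbers_prod_primesBelow_tsum
    h1 hmul hsum (N + 1)
  have hset : (N + 1).primesBelow = (Finset.Icc 1 N).filter Nat.Prime := by
    ext p
    simp only [Nat.mem_primesBelow, Finset.mem_filter, Finset.mem_Icc]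
    exact ⟨fun h => ⟨⟨h.2.one_le, by omega⟩, h.2⟩, fun h => ⟨by omega, h.2⟩⟩
  calc ∑ n ∈ Finset.Ioc 0 N, ‖divSum F n‖ / n = ∑ n ∈ (Finset.Ioc 0 N).attach, f n :=
        (Finset.sum_attach _ f).symm
    _ ≤ ∏ p ∈ (N + 1).primesBelow, ∑' k : ℕ, f (p ^ k) := by
        have hmem (n : ℕ) (hn : n ∈ Finset.Ioc 0 N) : n ∈ (N + 1).smoothNumbers := by
          obtain ⟨h0, hN⟩ := Finset.mem_Ioc.1 hn
          exact Nat.mem_smoothNumbers_of_lt h0 (by omega)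
        have := sum_le_hasSum
          ((Finset.Ioc 0 N).attach.map ⟨fun n => (⟨n.1, hmem n.1 n.2⟩ : (N + 1).smoothNumbers),
            fun a b h => Subtype.ext (Subtype.mk.inj h)⟩)
          (fun i _ => hf0 i) hS
        rw [Finset.sum_map] at this
        exact this
    _ ≤ ∏ p ∈ (N + 1).primesBelow, Real.exp (‖1 + F p‖ / p + 8 * (1 / (p : ℝ) ^ 2)) := by
        refine Finset.prod_le_prod (fun p _ => tsum_nonneg fun k => hf0 _) fun p hp => ?_
        exact (summable_and_tsum_divSum_prime_pow_le hF (Nat.prime_of_mem_primesBelow hp)).2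
    _ ≤ _ := by
        rw [← Real.exp_sum, hset, Real.exp_le_exp, Finset.sum_add_distrib, ← Finset.mul_sum]
        linarith [sum_one_div_sq_le_two ((Finset.Icc 1 N).filter Nat.Prime)]

/-- A Halberstam–Richert type bound for logarithmic means of completely multiplicative functions
with values in the unit disc. -/
lemma norm_sum_div_le_exp {F : ℕ →*₀ ℂ} (hF : ∀ n, ‖F n‖ ≤ 1) {N : ℕ} (hN : 2 ≤ N) :
    ‖∑ n ∈ Finset.Icc 1 N, F n / n‖ ≤ 1 + 13 / Real.log N *
      Real.exp (∑ p ∈ (Finset.Icc 1 N).filter Nat.Prime, ‖1 + F p‖ / p + 16) := by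
  have hN0 : (0 : ℝ) < N := by exact_mod_cast (by omega : 0 < N)
  have hlog : 0 < Real.log N := Real.log_pos (by exact_mod_cast (by omega : 1 < N))
  have h1 := norm_sum_div_le hF (N := N) (by omega)
  have h2 := sum_norm_divSum_mul_log_le' hF N
  have h3 := sum_norm_divSum_div_le hF N
  set S := ∑ n ∈ Finset.Ioc 0 N, ‖divSum F n‖
  set T := ∑ n ∈ Finset.Ioc 0 N, ‖divSum F n‖ / n
  set E := Real.exp (∑ p ∈ (Finset.Icc 1 N).filter Nat.Prime, ‖1 + F p‖ / p + 16)
  have hl4 : 2 * (Real.log 4 + 4) + 1 ≤ 13 := by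
    have : Real.log 4 = 2 * Real.log 2 := by
      rw [show (4 : ℝ) = 2 ^ 2 by norm_num, Real.log_pow]; norm_num
    linarith [Real.log_two_lt_d9]
  have hE : 0 < E := Real.exp_pos _
  have h4 : S * Real.log N ≤ 13 * N * E :=
    h2.trans (by gcongr)
  have h5 : S ≤ N * (13 / Real.log N * E) := by
    rw [← le_div_iff₀ hlog] at h4
    exact h4.trans (le_of_eq (by ring))
  have hI : Finset.Icc 1 N = Finset.Ioc 0 N := rfl
  rw [hI]
  refine le_of_mul_le_mul_left ?_ hN0
  linarith

end HalberstamRichert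

section PrimeSums

/-- The primes up to `x`. -/
noncomputable def primesUpTo (x : ℝ) : Finset ℕ := (Finset.Icc 1 ⌊x⌋₊).filter Nat.Prime

lemma prime_of_mem_primesUpTo {x : ℝ} {p : ℕ} (hp : p ∈ primesUpTo x) : p.Prime :=
  (Finset.mem_filter.1 hp).2

lemma sum_log_div_primesUpTo_le {x : ℝ} (hx : 1 ≤ x) :
    ∑ p ∈ primesUpTo x, Real.log p / p ≤ Real.log x + 6 := by
  set N := ⌊x⌋₊ with hNdef
  have hN1 : 1 ≤ N := Nat.one_le_floor_iff _ |>.2 hx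
  have hN0 : (0 : ℝ) < N := by exact_mod_cast hN1
  have hNx : (N : ℝ) ≤ x := Nat.floor_le (by linarith)
  have h := ArithmeticFunction.sum_Ioc_mul_zeta_eq_sum ArithmeticFunction.vonMangoldt N
  rw [ArithmeticFunction.vonMangoldt_mul_zeta] at h
  have h1 : ∑ n ∈ Finset.Ioc 0 N, ArithmeticFunction.log n ≤ N * Real.log x := by
    calc _ ≤ ∑ n ∈ Finset.Ioc 0 N, Real.log x := Finset.sum_le_sum fun n hn => by
          obtain ⟨h0, hn⟩ := Finset.mem_Ioc.1 hn
          rw [ArithmeticFunction.log_apply]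
          exact Real.log_le_log (by exact_mod_cast h0) (le_trans (by exact_mod_cast hn) hNx)
      _ = _ := by simp
  have h2 : N * ∑ n ∈ Finset.Ioc 0 N, ArithmeticFunction.vonMangoldt n / n ≤
      ∑ n ∈ Finset.Ioc 0 N, ArithmeticFunction.vonMangoldt n * ((N / n : ℕ) : ℝ) + 
        ∑ n ∈ Finset.Ioc 0 N, ArithmeticFunction.vonMangoldt n := by
    rw [Finset.mul_sum, ← Finset.sum_add_distrib]
    refine Finset.sum_le_sum fun n _ => ?_
    have h2 := Nat.lt_floor_add_one ((N : ℝ) / n)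
    rw [Nat.floor_div_natCast, Nat.floor_natCast] at h2
    calc (N : ℝ) * (ArithmeticFunction.vonMangoldt n / n)
        = ArithmeticFunction.vonMangoldt n * (N / n) := by ring
      _ ≤ ArithmeticFunction.vonMangoldt n * (((N / n : ℕ) : ℝ) + 1) :=
        mul_le_mul_of_nonneg_left h2.le ArithmeticFunction.vonMangoldt_nonneg
      _ = _ := by ring
  have h3 : ∑ n ∈ Finset.Ioc 0 N, ArithmeticFunction.vonMangoldt n ≤ 6 * N := by
    have h := Chebyshev.psi_le_const_mul_self hN0.le
    rw [Chebyshev.psi, Nat.floor_natCast] at h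
    have : Real.log 4 = 2 * Real.log 2 := by
      rw [show (4 : ℝ) = 2 ^ 2 by norm_num, Real.log_pow]; norm_num
    refine h.trans ?_
    gcongr
    linarith [Real.log_two_lt_d9]
  have h4 : ∑ n ∈ Finset.Ioc 0 N, ArithmeticFunction.vonMangoldt n / n ≤ Real.log x + 6 := by
    refine le_of_mul_le_mul_left ?_ hN0
    rw [← h] at h2
    linarith
  refine le_trans ?_ h4
  calc _ = ∑ p ∈ primesUpTo x, ArithmeticFunction.vonMangoldt p / p :=
        Finset.sum_congr rfl fun p hp => by
          rw [ArithmeticFunction.vonMangoldt_apply_prime (prime_of_mem_primesUpTo hp)]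
    _ ≤ _ := Finset.sum_le_sum_of_subset_of_nonneg (Finset.filter_subset _ _) fun n _ _ =>
        div_nonneg ArithmeticFunction.vonMangoldt_nonneg (Nat.cast_nonneg n)

/-- Moving the exponent from `1` to `1 + 1 / log x` changes a bounded weighted prime sum by `O(1)`. -/
lemma sum_primesUpTo_div_le_sum_rpow {x : ℝ} (hx : 2 ≤ x) {c : ℕ → ℝ} (hc0 : ∀ n, 0 ≤ c n)
    (hc2 : ∀ n, c n ≤ 2) :
    ∑ p ∈ primesUpTo x, c p / p ≤
      ∑ p ∈ primesUpTo x, c p * (p : ℝ) ^ (-(1 + 1 / Real.log x)) + 20 := by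
  have hl2 := Real.log_two_gt_d9
  have hlx : Real.log 2 ≤ Real.log x := Real.log_le_log (by norm_num) hx
  have hlog : 0 < Real.log x := by linarith
  have hM := sum_log_div_primesUpTo_le (x := x) (by linarith)
  have key : ∑ p ∈ primesUpTo x, (c p / p - c p * (p : ℝ) ^ (-(1 + 1 / Real.log x))) ≤
      ∑ p ∈ primesUpTo x, 2 / Real.log x * (Real.log p / p) := by
    refine Finset.sum_le_sum fun p hp => ?_
    have hpp := prime_of_mem_primesUpTo hp
    have hp0 : (0 : ℝ) < p := by exact_mod_cast hpp.pos
    have e : (p : ℝ) ^ (-(1 + 1 / Real.log x)) = (1 / p) * Real.exp (-(Real.log p / Real.log x)) := by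
      rw [Real.rpow_def_of_pos hp0, mul_neg, mul_add, neg_add, Real.exp_add, mul_one, Real.exp_neg,
        Real.exp_log hp0]
      ring_nf
    rw [e]
    have h1 := Real.add_one_le_exp (-(Real.log p / Real.log x))
    have h2 : 0 ≤ Real.log p / Real.log x :=
      div_nonneg (Real.log_nonneg (by exact_mod_cast hpp.one_le)) hlog.le
    calc c p / p - c p * (1 / p * Real.exp (-(Real.log p / Real.log x)))
        = c p * (1 - Real.exp (-(Real.log p / Real.log x))) / p := by ring
      _ ≤ 2 * (Real.log p / Real.log x) / p := by
        gcongr ?_ / _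
        calc _ ≤ c p * (Real.log p / Real.log x) := by
              gcongr
              · exact hc0 p
              · linarith
          _ ≤ _ := by gcongr; exact hc2 p
      _ = _ := by ring
  rw [Finset.sum_sub_distrib, ← Finset.mul_sum] at key
  have h5 : 2 / Real.log x * ∑ p ∈ primesUpTo x, Real.log p / p ≤ 20 := by
    calc _ ≤ 2 / Real.log x * (Real.log x + 6) := by gcongr
      _ ≤ 20 := by
        rw [div_mul_eq_mul_div, div_le_iff₀ hlog]
        linarith
  linarith

lemma re_sub_sq_le_neg_log_norm {w : ℂ} (hw : ‖w‖ < 1) :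
    w.re - ‖w‖ ^ 2 / 2 ≤ -Real.log ‖1 - w‖ := by
  have hne : 1 - w ≠ 0 := fun h => by
    rw [← sub_eq_zero.1 h, norm_one] at hw; exact lt_irrefl _ hw
  have hpos : 0 < ‖1 - w‖ := norm_pos_iff.2 hne
  have h := Real.log_le_sub_one_of_pos (pow_pos hpos 2)
  rw [Real.log_pow] at h
  have e : ‖1 - w‖ ^ 2 = 1 - 2 * w.re + ‖w‖ ^ 2 := by
    rw [← Complex.normSq_eq_norm_sq, ← Complex.normSq_eq_norm_sq, Complex.normSq_apply,
      Complex.normSq_apply]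
    simp; ring
  rw [e] at h
  push_cast at h
  linarith

/-- The Euler product bounds the prime sum by the logarithm of the Dirichlet series. -/
lemma tsum_primes_re_le_log_norm_tsum {f : ℕ →*₀ ℂ} (hsum : Summable (‖f ·‖))
    (hf : ∀ n, ‖f n‖ ≤ 1 / n) :
    0 < ‖∑' n, f n‖ ∧ ∑' p : Nat.Primes, (f p).re ≤ Real.log ‖∑' n, f n‖ + 1 := by
  have hexp := EulerProduct.exp_tsum_primes_log_eq_tsum hsum
  have hlt (p : Nat.Primes) : ‖f p‖ < 1 := by
    refine (hf p).trans_lt ?_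
    have : (1 : ℝ) < (p : ℕ) := by exact_mod_cast p.2.one_lt
    rw [div_lt_one (by linarith)]; exact this
  have hfs : Summable (fun p : Nat.Primes => f p) := hsum.of_norm.subtype Nat.Prime
  have hls : Summable (fun p : Nat.Primes => -Complex.log (1 - f p)) :=
    (hsum.of_norm.clog_one_sub.neg).subtype Nat.Prime
  rw [← hexp, Complex.norm_exp, Real.log_exp]
  refine ⟨Real.exp_pos _, ?_⟩
  rw [Complex.re_tsum hls]
  have hinv : Summable (fun n : ℕ => 1 / (n : ℝ) ^ 2) := hasSum_zeta_two.summable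
  have hinvp : Summable (fun p : Nat.Primes => 1 / ((p : ℕ) : ℝ) ^ 2) := hinv.subtype Nat.Prime
  have hle2 : ∑' p : Nat.Primes, 1 / ((p : ℕ) : ℝ) ^ 2 ≤ 2 := by
    refine (Summable.tsum_subtype_le _ {p : ℕ | p.Prime} (fun _ => by positivity) hinv).trans ?_
    rw [hasSum_zeta_two.tsum_eq]
    nlinarith [Real.pi_lt_d2, Real.pi_pos]
  have hre : Summable (fun p : Nat.Primes => (f p).re) := (Complex.hasSum_re hfs.hasSum).summable
  have hrel : Summable (fun p : Nat.Primes => (-Complex.log (1 - f p)).re) :=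
    (Complex.hasSum_re hls.hasSum).summable
  have hmain : ∑' p : Nat.Primes, (f p).re ≤
      ∑' p : Nat.Primes, ((-Complex.log (1 - f p)).re + 1 / ((p : ℕ) : ℝ) ^ 2 * (1 / 2)) := by
    refine hre.tsum_le_tsum (fun p => ?_) (hrel.add (hinvp.mul_right _))
    have h := re_sub_sq_le_neg_log_norm (hlt p)
    rw [Complex.neg_re, Complex.log_re]
    have h2 : ‖f p‖ ^ 2 ≤ 1 / ((p : ℕ) : ℝ) ^ 2 := by
      rw [← one_div_pow]
      gcongr
      exact hf p
    linarith
  rw [hrel.tsum_add (hinvp.mul_right _), tsum_mul_right] at hmain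
  linarith

/-- The completely multiplicative function `n ↦ χ(n) n^{-σ}`. -/
noncomputable def twistHom {m : ℕ} (χ : DirichletCharacter ℂ m) {σ : ℝ} (hσ : 1 < σ) : ℕ →*₀ ℂ where
  toFun n := χ n * (((n : ℝ) ^ (-σ) : ℝ) : ℂ)
  map_zero' := by
    have : (-σ) ≠ 0 := by linarith
    simp [Real.zero_rpow this]
  map_one' := by simp
  map_mul' a b := by
    simp only [Nat.cast_mul, map_mul, Real.mul_rpow (Nat.cast_nonneg a) (Nat.cast_nonneg b),
      Complex.ofReal_mul]
    ring

lemma twistHom_apply {m : ℕ} (χ : DirichletCharacter ℂ m) {σ : ℝ} (hσ : 1 < σ) (n : ℕ) :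
    twistHom χ hσ n = χ n * (((n : ℝ) ^ (-σ) : ℝ) : ℂ) := rfl

lemma norm_twistHom_le {m : ℕ} (χ : DirichletCharacter ℂ m) {σ : ℝ} (hσ : 1 < σ) (n : ℕ) :
    ‖twistHom χ hσ n‖ ≤ (n : ℝ) ^ (-σ) := by
  rw [twistHom_apply, norm_mul, Complex.norm_real,
    Real.norm_of_nonneg (Real.rpow_nonneg (Nat.cast_nonneg n) _)]
  exact mul_le_of_le_one_left (Real.rpow_nonneg (Nat.cast_nonneg n) _) (χ.norm_le_one _)

lemma rpow_neg_le_one_div {σ : ℝ} (hσ : 1 < σ) (n : ℕ) : (n : ℝ) ^ (-σ) ≤ 1 / n := by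
  rcases Nat.eq_zero_or_pos n with rfl | hn
  · have : (-σ) ≠ 0 := by linarith
    simp [Real.zero_rpow this]
  · rw [one_div, ← Real.rpow_neg_one]
    exact Real.rpow_le_rpow_of_exponent_le (by exact_mod_cast hn) (by linarith)

lemma summable_norm_twistHom {m : ℕ} (χ : DirichletCharacter ℂ m) {σ : ℝ} (hσ : 1 < σ) :
    Summable (‖twistHom χ hσ ·‖) :=
  Summable.of_nonneg_of_le (fun _ => norm_nonneg _) (norm_twistHom_le χ hσ)
    (Real.summable_nat_rpow.2 (by linarith))

lemma tsum_rpow_neg_le {σ : ℝ} (hσ : 1 < σ) : ∑' n : ℕ, (n : ℝ) ^ (-σ) ≤ 1 + 1 / (σ - 1) := by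
  have h := ZetaAsymptotics.zeta_limit_aux1 hσ
  have h0 : 0 ≤ ZetaAsymptotics.termTSum σ := tsum_nonneg fun n => ZetaAsymptotics.term_nonneg _ _
  have hs : Summable (fun n : ℕ => (n : ℝ) ^ (-σ)) := Real.summable_nat_rpow.2 (by linarith)
  have hne : (-σ) ≠ 0 := by linarith
  have e : ∑' n : ℕ, (n : ℝ) ^ (-σ) = ∑' n : ℕ, 1 / (n + 1 : ℝ) ^ σ := by
    rw [hs.tsum_eq_zero_add]
    simp only [Nat.cast_zero, Real.zero_rpow hne, zero_add]
    refine tsum_congr fun n => ?_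
    rw [Real.rpow_neg (by positivity), one_div]
    push_cast; rfl
  rw [e]
  nlinarith

end PrimeSums

section DirichletBounds

lemma sum_range_period_eq_zero {m : ℕ} [NeZero m] {θ : DirichletCharacter ℂ m} (hθ : θ ≠ 1) (n : ℕ) :
    ∑ i ∈ Finset.range m, θ ((n + i : ℕ) : ZMod m) = 0 := by
  have h : ∑ i ∈ Finset.range m, θ ((n + i : ℕ) : ZMod m) = ∑ a : ZMod m, θ (n + a) := by
    refine Finset.sum_bij (fun i _ => (i : ZMod m)) (fun _ _ => Finset.mem_univ _) ?_ ?_ ?_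
    · intro a ha b hb hab
      have := congrArg ZMod.val hab
      rwa [ZMod.val_cast_of_lt (Finset.mem_range.1 ha), ZMod.val_cast_of_lt (Finset.mem_range.1 hb)]
        at this
    · intro b _
      exact ⟨b.val, Finset.mem_range.2 (ZMod.val_lt b), ZMod.natCast_zmod_val b⟩
    · intro i _
      push_cast; rfl
  rw [h, Fintype.sum_equiv (Equiv.addLeft (n : ZMod m)) (fun a => θ (n + a)) (fun a => θ a)
    (fun _ => rfl)]
  exact MulChar.sum_eq_zero_of_ne_one hθ

lemma norm_sum_range_char_le {m : ℕ} [NeZero m] {θ : DirichletCharacter ℂ m} (hθ : θ ≠ 1) (n : ℕ) :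
    ‖∑ i ∈ Finset.range n, θ (i : ZMod m)‖ ≤ m := by
  induction n using Nat.strong_induction_on with
  | _ n ih =>
    rcases le_or_gt n m with h | h
    · calc _ ≤ ∑ i ∈ Finset.range n, ‖θ (i : ZMod m)‖ := norm_sum_le _ _
        _ ≤ ∑ i ∈ Finset.range n, (1 : ℝ) := Finset.sum_le_sum fun i _ => θ.norm_le_one _
        _ ≤ m := by simpa using h
    · obtain ⟨k, rfl⟩ := Nat.exists_eq_add_of_le' h.le
      rw [Finset.sum_range_add, sum_range_period_eq_zero hθ, add_zero]
      exact ih k (by have := NeZero.pos m; omega)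

lemma norm_sum_Ioc_smul_le {g : ℕ → ℂ} {B : ℝ} (hg : ∀ n, ‖∑ i ∈ Finset.range n, g i‖ ≤ B)
    {f : ℕ → ℝ} {m : ℕ} (hf0 : ∀ n, 0 ≤ f n) (hf : ∀ n, m < n → f (n + 1) ≤ f n) (n : ℕ) :
    ‖∑ i ∈ Finset.Ioc m n, f i • g i‖ ≤ 2 * B * f (m + 1) := by
  have hB : 0 ≤ B := (norm_nonneg _).trans (hg 0)
  rcases le_or_gt n m with h | h
  · rw [Finset.Ioc_eq_empty (by omega)]
    simpa using mul_nonneg (by positivity) (hf0 _)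
  · rw [Finset.sum_Ioc_by_parts _ _ h]
    have h1 (k l : ℕ) : ‖f k • ∑ i ∈ Finset.range l, g i‖ ≤ f k * B := by
      rw [norm_smul, Real.norm_of_nonneg (hf0 k)]
      exact mul_le_mul_of_nonneg_left (hg l) (hf0 k)
    have htel : ∑ i ∈ Finset.Ioc m (n - 1), (f i - f (i + 1)) = f (m + 1) - f n := by
      obtain ⟨k, rfl⟩ := Nat.exists_eq_add_of_lt h
      clear h
      have e : Finset.Ioc m (m + k + 1 - 1) = Finset.Ico (m + 1) (m + 1 + k) := by
        ext; simp; omega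
      rw [e, Finset.sum_Ico_eq_sum_range, Nat.add_sub_cancel_left]
      have := Finset.sum_range_sub' (fun i => f (m + 1 + i)) k
      simp only [add_zero] at this
      rw [show m + k + 1 = m + 1 + k by omega, ← this]
      rfl
    have h2 : ‖∑ i ∈ Finset.Ioc m (n - 1), (f (i + 1) - f i) • ∑ j ∈ Finset.range (i + 1), g j‖ ≤
        (f (m + 1) - f n) * B := by
      rw [← htel, Finset.sum_mul]
      refine (norm_sum_le _ _).trans (Finset.sum_le_sum fun i hi => ?_)
      have := hf i (Finset.mem_Ioc.1 hi).1
      rw [norm_smul, Real.norm_of_nonpos (by linarith), neg_sub]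
      exact mul_le_mul_of_nonneg_left (hg _) (by linarith)
    calc _ ≤ f n * B + f (m + 1) * B + (f (m + 1) - f n) * B :=
          (norm_sub_le _ _).trans (add_le_add ((norm_sub_le _ _).trans
            (add_le_add (h1 _ _) (h1 _ _))) h2)
      _ = _ := by ring

lemma norm_tsum_twistHom_le {m : ℕ} [NeZero m] {θ : DirichletCharacter ℂ m} (hθ : θ ≠ 1) {σ : ℝ}
    (hσ : 1 < σ) : ‖∑' n, twistHom θ hσ n‖ ≤ 3 + Real.log m := by
  have hm : 0 < m := NeZero.pos m
  have hlim := (((summable_norm_twistHom θ hσ).of_norm).hasSum.tendsto_sum_nat).norm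
  refine le_of_tendsto (hlim.comp (Filter.tendsto_add_atTop_nat (m + 1))) (Filter.Eventually.of_forall fun k => ?_)
  simp only [Function.comp]
  have hsplit : ∑ i ∈ Finset.range (k + (m + 1)), twistHom θ hσ i =
      ∑ i ∈ Finset.Icc 1 m, twistHom θ hσ i + ∑ i ∈ Finset.Ioc m (m + k), twistHom θ hσ i := by
    rw [Finset.range_eq_Ico, Finset.sum_eq_sum_Ico_succ_bot (by omega), map_zero, zero_add,
      ← Finset.sum_Ico_consecutive _ (show 0 + 1 ≤ m + 1 by omega) (show m + 1 ≤ k + (m + 1) by omega)]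
    congr 1
    refine Finset.sum_congr ?_ fun _ _ => rfl
    ext; simp; omega
  rw [hsplit]
  have hhead : ‖∑ i ∈ Finset.Icc 1 m, twistHom θ hσ i‖ ≤ 1 + Real.log m := by
    have h := harmonic_le_one_add_log m
    rw [harmonic_eq_sum_Icc] at h
    push_cast at h
    refine (norm_sum_le _ _).trans ((Finset.sum_le_sum fun i _ => ?_).trans h)
    rw [← one_div]
    exact (norm_twistHom_le θ hσ i).trans (rpow_neg_le_one_div hσ i)
  have htail : ‖∑ i ∈ Finset.Ioc m (m + k), twistHom θ hσ i‖ ≤ 2 := by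
    have h := norm_sum_Ioc_smul_le (g := fun i => θ (i : ZMod m)) (norm_sum_range_char_le hθ)
      (f := fun i => (i : ℝ) ^ (-σ)) (m := m) (fun n => Real.rpow_nonneg (Nat.cast_nonneg n) _)
      (fun n hn => Real.rpow_le_rpow_of_nonpos (by exact_mod_cast (by omega : 0 < n))
        (by push_cast; linarith) (by linarith)) (m + k)
    have e : ∀ i ∈ Finset.Ioc m (m + k), twistHom θ hσ i = ((i : ℝ) ^ (-σ)) • θ (i : ZMod m) := by
      intro i _
      rw [twistHom_apply, Complex.real_smul, mul_comm]
    rw [Finset.sum_congr rfl e]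
    refine h.trans ?_
    have h1 := rpow_neg_le_one_div hσ (m + 1)
    have h2 : (m : ℝ) * (1 / ((m + 1 : ℕ) : ℝ)) ≤ 1 := by
      rw [mul_one_div, div_le_one (by positivity)]; push_cast; linarith
    have h3 := mul_le_mul_of_nonneg_left h1 (Nat.cast_nonneg (α := ℝ) m)
    nlinarith
  calc _ ≤ _ := norm_add_le _ _
    _ ≤ _ := by linarith

lemma sum_primesUpTo_le_tsum {g : ℕ → ℝ} (hg : ∀ n, 0 ≤ g n) (hs : Summable g) (x : ℝ) :
    ∑ p ∈ primesUpTo x, g p ≤ ∑' p : Nat.Primes, g p := by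
  have h : Summable (fun p : Nat.Primes => g p) := hs.subtype Nat.Prime
  let s : Finset Nat.Primes := (primesUpTo x).subtype Nat.Prime
  have e : ∑ p ∈ primesUpTo x, g p = ∑ p ∈ s, g p :=
    (Finset.sum_subtype_of_mem g (fun p hp => prime_of_mem_primesUpTo hp)).symm
  rw [e]
  exact h.sum_le_tsum s fun p _ => hg p

lemma tsum_primes_rpow_le {σ : ℝ} (hσ : 1 < σ) :
    ∑' p : Nat.Primes, ((p : ℕ) : ℝ) ^ (-σ) ≤ Real.log (1 + 1 / (σ - 1)) + 1 := by
  obtain ⟨h0, h1⟩ := tsum_primes_re_le_log_norm_tsum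
    (summable_norm_twistHom (1 : DirichletCharacter ℂ 1) hσ)
    (fun n => (norm_twistHom_le _ hσ n).trans (rpow_neg_le_one_div hσ n))
  have e (n : ℕ) : twistHom (1 : DirichletCharacter ℂ 1) hσ n = (((n : ℝ) ^ (-σ) : ℝ) : ℂ) := by
    rw [twistHom_apply, Subsingleton.elim (n : ZMod 1) 1, map_one, one_mul]
  simp only [e, Complex.ofReal_re] at h0 h1
  refine h1.trans ?_
  gcongr
  rw [← Complex.ofReal_tsum, Complex.norm_real, Real.norm_of_nonneg
    (tsum_nonneg fun n => Real.rpow_nonneg (Nat.cast_nonneg n) _)]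
  exact tsum_rpow_neg_le hσ

lemma sum_primesUpTo_one_div_le {x : ℝ} (hx : 2 ≤ x) :
    ∑ p ∈ primesUpTo x, 1 / (p : ℝ) ≤ Real.log (1 + Real.log x) + 21 := by
  have hlog : 0 < Real.log x := Real.log_pos (by linarith)
  have hσ : 1 < 1 + 1 / Real.log x := by have := one_div_pos.2 hlog; linarith
  have h1 := sum_primesUpTo_div_le_sum_rpow hx (c := fun _ => 1) (fun _ => zero_le_one)
    (fun _ => one_le_two)
  have h2 := sum_primesUpTo_le_tsum (g := fun n => (n : ℝ) ^ (-(1 + 1 / Real.log x)))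
    (fun n => Real.rpow_nonneg (Nat.cast_nonneg n) _) (Real.summable_nat_rpow.2 (by linarith)) x
  have h3 := tsum_primes_rpow_le hσ
  rw [add_sub_cancel_left, one_div_one_div] at h3
  simp only [one_mul] at h1
  linarith

lemma sum_primesUpTo_one_add_re_div_le {x : ℝ} (hx : 2 ≤ x) {m : ℕ} [NeZero m]
    {θ : DirichletCharacter ℂ m} (hθ : θ ≠ 1) :
    ∑ p ∈ primesUpTo x, (1 + (θ (p : ZMod m)).re) / (p : ℝ) ≤
      Real.log (1 + Real.log x) + Real.log (3 + Real.log m) + 22 := by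
  have hlog : 0 < Real.log x := Real.log_pos (by linarith)
  have hσ : 1 < 1 + 1 / Real.log x := by have := one_div_pos.2 hlog; linarith
  have hre (n : ℕ) : |(θ (n : ZMod m)).re| ≤ 1 := (Complex.abs_re_le_norm _).trans (θ.norm_le_one _)
  have h1 := sum_primesUpTo_div_le_sum_rpow hx (c := fun n => 1 + (θ (n : ZMod m)).re)
    (fun n => by linarith [(abs_le.1 (hre n)).1]) (fun n => by linarith [(abs_le.1 (hre n)).2])
  have hs1 : Summable (fun n : ℕ => (n : ℝ) ^ (-(1 + 1 / Real.log x))) :=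
    Real.summable_nat_rpow.2 (by linarith)
  have hs2 : Summable (fun n : ℕ => (twistHom θ hσ n).re) :=
    (Complex.hasSum_re (summable_norm_twistHom θ hσ).of_norm.hasSum).summable
  have e (n : ℕ) : (1 + (θ (n : ZMod m)).re) * (n : ℝ) ^ (-(1 + 1 / Real.log x)) =
      (n : ℝ) ^ (-(1 + 1 / Real.log x)) + (twistHom θ hσ n).re := by
    rw [twistHom_apply, Complex.re_mul_ofReal]; ring
  simp only [e] at h1
  have h2 := sum_primesUpTo_le_tsum
    (g := fun n => (n : ℝ) ^ (-(1 + 1 / Real.log x)) + (twistHom θ hσ n).re)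
    (fun n => by
      rw [← e]
      exact mul_nonneg (by linarith [(abs_le.1 (hre n)).1]) (Real.rpow_nonneg (Nat.cast_nonneg n) _))
    (hs1.add hs2) x
  have hs1' : Summable (fun p : Nat.Primes => ((p : ℕ) : ℝ) ^ (-(1 + 1 / Real.log x))) :=
    hs1.subtype Nat.Prime
  have hs2' : Summable (fun p : Nat.Primes => (twistHom θ hσ p).re) := hs2.subtype Nat.Prime
  rw [hs1'.tsum_add hs2'] at h2
  have h3 := tsum_primes_rpow_le hσ
  rw [add_sub_cancel_left, one_div_one_div] at h3
  obtain ⟨h4, h5⟩ := tsum_primes_re_le_log_norm_tsum (summable_norm_twistHom θ hσ)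
    (fun n => (norm_twistHom_le _ hσ n).trans (rpow_neg_le_one_div hσ n))
  have h6 := Real.log_le_log h4 (norm_tsum_twistHom_le hθ hσ)
  linarith

lemma card_primeFactors_mul_log_two_le {d : ℕ} (hd : d ≠ 0) :
    (d.primeFactors.card : ℝ) * Real.log 2 ≤ Real.log d := by
  rw [← Real.log_pow]
  refine Real.log_le_log (by positivity) ?_
  have h1 : 2 ^ d.primeFactors.card ≤ ∏ p ∈ d.primeFactors, p :=
    Finset.pow_card_le_prod _ _ _ fun p hp => (Nat.prime_of_mem_primeFactors hp).two_le
  have h2 := Nat.le_of_dvd (Nat.pos_of_ne_zero hd) (Nat.prod_primeFactors_dvd d)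
  exact_mod_cast h1.trans h2

lemma sum_primeFactors_one_div_le {d : ℕ} (hd : d ≠ 0) {T : ℝ} (hT : 2 ≤ T)
    (hdT : Real.log d ≤ T) :
    ∑ p ∈ d.primeFactors, 1 / (p : ℝ) ≤ Real.log (1 + Real.log T) + 23 := by
  have h1 := sum_primesUpTo_one_div_le hT
  have hsplit := Finset.sum_filter_add_sum_filter_not d.primeFactors (fun p : ℕ => (p : ℝ) ≤ T)
    (fun p => 1 / (p : ℝ))
  have hsmall : ∑ p ∈ d.primeFactors.filter (fun p : ℕ => (p : ℝ) ≤ T), 1 / (p : ℝ) ≤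
      ∑ p ∈ primesUpTo T, 1 / (p : ℝ) := by
    refine Finset.sum_le_sum_of_subset_of_nonneg (fun p hp => ?_) (fun _ _ _ => by positivity)
    obtain ⟨hp1, hp2⟩ := Finset.mem_filter.1 hp
    have hpp := Nat.prime_of_mem_primeFactors hp1
    exact Finset.mem_filter.2 ⟨Finset.mem_Icc.2 ⟨hpp.one_le, Nat.le_floor hp2⟩, hpp⟩
  have hlarge : ∑ p ∈ d.primeFactors.filter (fun p : ℕ => ¬(p : ℝ) ≤ T), 1 / (p : ℝ) ≤ 2 := by
    have hc := card_primeFactors_mul_log_two_le hd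
    have hcard : ((d.primeFactors.filter (fun p : ℕ => ¬(p : ℝ) ≤ T)).card : ℝ) ≤
        d.primeFactors.card := by exact_mod_cast Finset.card_filter_le _ _
    have h := Finset.sum_le_card_nsmul (d.primeFactors.filter (fun p : ℕ => ¬(p : ℝ) ≤ T))
      (fun p => 1 / (p : ℝ)) (1 / T) fun p hp => by
        have := (Finset.mem_filter.1 hp).2
        exact one_div_le_one_div_of_le (by linarith) (by linarith)
    refine h.trans ?_
    rw [nsmul_eq_mul, mul_one_div, div_le_iff₀ (by linarith)]
    have := Real.log_two_gt_d9
    nlinarith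
  linarith

end DirichletBounds

section Characters

lemma changeLevel_eq_of_changeLevel_eq {a b m d : ℕ} [NeZero m] {ξ : DirichletCharacter ℂ a}
    {η : DirichletCharacter ℂ b} (hab : a = b) (ha : a ∣ m) (hb : b ∣ m)
    (h : DirichletCharacter.changeLevel ha ξ = DirichletCharacter.changeLevel hb η) (had : a ∣ d)
    (hbd : b ∣ d) : DirichletCharacter.changeLevel had ξ = DirichletCharacter.changeLevel hbd η := by
  subst hab
  rw [DirichletCharacter.changeLevel_injective ha h]

lemma changeLevel_apply_of_coprime {a m : ℕ} (ξ : DirichletCharacter ℂ a) (ha : a ∣ m) {n : ℕ}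
    (hn : n.Coprime m) : DirichletCharacter.changeLevel ha ξ (n : ZMod m) = ξ (n : ZMod a) := by
  have := DirichletCharacter.changeLevel_eq_cast_of_dvd' ξ ha (a := n)
    (Nat.isCoprime_iff_coprime.2 hn)
  simpa using this

lemma char_apply_eq_zero_of_not_coprime {a : ℕ} (ξ : DirichletCharacter ℂ a) {n : ℕ}
    (hn : ¬ n.Coprime a) : ξ (n : ZMod a) = 0 :=
  ξ.map_nonunit (by rwa [ZMod.isUnit_iff_coprime])

lemma inv_apply_eq_conj {a : ℕ} [NeZero a] (ξ : DirichletCharacter ℂ a) (x : ZMod a) :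
    ξ⁻¹ x = (starRingEnd ℂ) (ξ x) := by
  rw [← MulChar.star_apply', starRingEnd_apply]

/-- For `ξ` primitive not inducing `ψ`, the function `ξ · conj ψ*` is a nonprincipal character. -/
lemma exists_ne_one_char_mul_conj {D d : ℕ} [NeZero D] [NeZero d] {ξ : DirichletCharacter ℂ D}
    (hξ : ξ.IsPrimitive) {ψ : DirichletCharacter ℂ d}
    (hψ : ¬ ∃ h : D ∣ d, ψ = DirichletCharacter.changeLevel h ξ) :
    ∃ θ : DirichletCharacter ℂ (D * ψ.conductor), θ ≠ 1 ∧ ∀ n : ℕ, θ (n : ZMod (D * ψ.conductor)) =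
      ξ (n : ZMod D) * (starRingEnd ℂ) (ψ.primitiveCharacter (n : ZMod ψ.conductor)) := by
  have hc : ψ.conductor ≠ 0 := ψ.conductor_ne_zero
  have : NeZero ψ.conductor := ⟨hc⟩
  have : NeZero (D * ψ.conductor) := ⟨mul_ne_zero (NeZero.ne D) hc⟩
  have h1 : D ∣ D * ψ.conductor := dvd_mul_right _ _
  have h2 : ψ.conductor ∣ D * ψ.conductor := dvd_mul_left _ _
  refine ⟨DirichletCharacter.changeLevel h1 ξ *
    (DirichletCharacter.changeLevel h2 ψ.primitiveCharacter)⁻¹, fun h => hψ ?_, fun n => ?_⟩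
  · rw [mul_inv_eq_one] at h
    have hcond : D = ψ.conductor := by
      have := congrArg DirichletCharacter.conductor h
      rw [DirichletCharacter.conductor_changeLevel, DirichletCharacter.conductor_changeLevel] at this
      rwa [(DirichletCharacter.isPrimitive_def _).1 hξ,
        (DirichletCharacter.isPrimitive_def _).1 ψ.primitiveCharacter_isPrimitive] at this
    have hd : D ∣ d := hcond.symm ▸ ψ.conductor_dvd_level
    refine ⟨hd, ?_⟩
    rw [changeLevel_eq_of_changeLevel_eq hcond h1 h2 h hd ψ.conductor_dvd_level,
      DirichletCharacter.changeLevel_primitiveCharacter]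
  · rw [MulChar.mul_apply, inv_apply_eq_conj]
    by_cases hn : n.Coprime (D * ψ.conductor)
    · rw [changeLevel_apply_of_coprime _ _ hn, changeLevel_apply_of_coprime _ _ hn]
    · rw [char_apply_eq_zero_of_not_coprime _ hn, zero_mul]
      rw [Nat.coprime_mul_iff_right, not_and_or] at hn
      rcases hn with hn | hn
      · rw [char_apply_eq_zero_of_not_coprime _ hn, zero_mul]
      · rw [char_apply_eq_zero_of_not_coprime _ hn, map_zero, mul_zero]

lemma sum_one_add_re_mul_conj_le {D d : ℕ} [NeZero d] {ξ : DirichletCharacter ℂ D}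
    (hξ : ξ.IsPrimitive) {ψ : DirichletCharacter ℂ d}
    (hψ : ¬ ∃ h : D ∣ d, ψ = DirichletCharacter.changeLevel h ξ) {y : ℝ} (hy : 2 ≤ y)
    (hly : 1 ≤ Real.log y) (hD : (D : ℝ) ≤ Real.log y) (hc : (ψ.conductor : ℝ) ≤ Real.log y) :
    ∑ p ∈ primesUpTo y, (1 + (ξ (p : ZMod D) *
      (starRingEnd ℂ) (ψ.primitiveCharacter (p : ZMod ψ.conductor))).re) / (p : ℝ) ≤
      Real.log (1 + Real.log y) + Real.log (3 + 2 * Real.log (Real.log y)) + 22 := by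
  have hll : 0 ≤ Real.log (Real.log y) := Real.log_nonneg hly
  rcases Nat.eq_zero_or_pos D with rfl | hpos
  · have h := sum_primesUpTo_one_div_le hy
    have h3 : 0 ≤ Real.log (3 + 2 * Real.log (Real.log y)) := Real.log_nonneg (by linarith)
    rw [Finset.sum_congr rfl fun p hp => by
      rw [char_apply_eq_zero_of_not_coprime ξ (n := p) (by
        rw [Nat.coprime_zero_right]; exact (prime_of_mem_primesUpTo hp).ne_one), zero_mul,
        Complex.zero_re, add_zero]]
    linarith
  · have : NeZero D := ⟨hpos.ne'⟩
    have hcp : 0 < ψ.conductor := Nat.pos_of_ne_zero ψ.conductor_ne_zero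
    have : NeZero (D * ψ.conductor) := ⟨(mul_pos hpos hcp).ne'⟩
    obtain ⟨θ, hθ, he⟩ := exists_ne_one_char_mul_conj hξ hψ
    have h := sum_primesUpTo_one_add_re_div_le hy hθ
    simp only [he] at h
    refine h.trans ?_
    have hD0 : (0 : ℝ) < D := by exact_mod_cast hpos
    have hc0 : (0 : ℝ) < ψ.conductor := by exact_mod_cast hcp
    have hm : Real.log ((D * ψ.conductor : ℕ) : ℝ) ≤ 2 * Real.log (Real.log y) := by
      rw [Nat.cast_mul, Real.log_mul hD0.ne' hc0.ne']
      linarith [Real.log_le_log hD0 hD, Real.log_le_log hc0 hc]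
    have h0 : 0 ≤ Real.log ((D * ψ.conductor : ℕ) : ℝ) :=
      Real.log_nonneg (by exact_mod_cast Nat.mul_pos hpos hcp)
    gcongr

end Characters

section Repulsion

lemma norm_add_le_mul_one_add_re {b c : ℂ} (hb : ‖b‖ ≤ 1) (hc : ‖c‖ ≤ 1) :
    ‖b + c‖ ≤ Real.sqrt 2 / 2 * (1 + (1 + (b * (starRingEnd ℂ) c).re)) := by
  have hs : Real.sqrt 2 ^ 2 = 2 := Real.sq_sqrt (by norm_num)
  have hs0 : 0 < Real.sqrt 2 := by positivity
  have e : ‖b + c‖ ^ 2 = ‖b‖ ^ 2 + ‖c‖ ^ 2 + 2 * (b * (starRingEnd ℂ) c).re := by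
    simp only [← Complex.normSq_eq_norm_sq]
    exact Complex.normSq_add b c
  have hb2 : ‖b‖ ^ 2 ≤ 1 := pow_le_one₀ (norm_nonneg _) hb
  have hc2 : ‖c‖ ^ 2 ≤ 1 := pow_le_one₀ (norm_nonneg _) hc
  nlinarith [sq_nonneg (‖b + c‖ - Real.sqrt 2)]

/-- If `a` is at least as close to `b` as to `c`, then it is far from `c` provided `b` is. -/
lemma sum_one_add_re_le_of_closer {S : Finset ℕ} {a b c : ℕ → ℂ} (ha : ∀ n, ‖a n‖ ≤ 1)
    (hb : ∀ n, ‖b n‖ ≤ 1) (hc : ∀ n, ‖c n‖ ≤ 1)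
    (h : ∑ p ∈ S, (1 - (a p * (starRingEnd ℂ) (b p)).re) / (p : ℝ) ≤
      ∑ p ∈ S, (1 - (a p * (starRingEnd ℂ) (c p)).re) / (p : ℝ)) :
    ∑ p ∈ S, (1 + (a p * (starRingEnd ℂ) (c p)).re) / (p : ℝ) ≤
      ∑ p ∈ S, 1 / (p : ℝ) + Real.sqrt 2 / 4 * (∑ p ∈ S, 1 / (p : ℝ) +
        ∑ p ∈ S, (1 + (b p * (starRingEnd ℂ) (c p)).re) / (p : ℝ)) := by
  have key : ∑ p ∈ S, (1 + (a p * (starRingEnd ℂ) (c p)).re +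
      (1 + (a p * (starRingEnd ℂ) (b p)).re)) / (p : ℝ) ≤
      ∑ p ∈ S, (2 + Real.sqrt 2 / 2 * (1 + (1 + (b p * (starRingEnd ℂ) (c p)).re))) / (p : ℝ) := by
    refine Finset.sum_le_sum fun p _ => ?_
    gcongr ?_ / _
    have h1 : (a p * (starRingEnd ℂ) (b p + c p)).re ≤ ‖b p + c p‖ := by
      refine (Complex.re_le_norm _).trans ?_
      rw [norm_mul, Complex.norm_conj]
      exact mul_le_of_le_one_left (norm_nonneg _) (ha p)
    rw [map_add, mul_add, Complex.add_re] at h1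
    linarith [norm_add_le_mul_one_add_re (hb p) (hc p)]
  have e1 : ∑ p ∈ S, (1 + (a p * (starRingEnd ℂ) (c p)).re +
      (1 + (a p * (starRingEnd ℂ) (b p)).re)) / (p : ℝ) =
      2 * ∑ p ∈ S, (1 + (a p * (starRingEnd ℂ) (c p)).re) / (p : ℝ) +
      (∑ p ∈ S, (1 - (a p * (starRingEnd ℂ) (c p)).re) / (p : ℝ) -
        ∑ p ∈ S, (1 - (a p * (starRingEnd ℂ) (b p)).re) / (p : ℝ)) := by
    rw [Finset.mul_sum, ← Finset.sum_sub_distrib, ← Finset.sum_add_distrib]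
    exact Finset.sum_congr rfl fun p _ => by ring
  have e2 : ∑ p ∈ S, (2 + Real.sqrt 2 / 2 * (1 + (1 + (b p * (starRingEnd ℂ) (c p)).re))) / (p : ℝ) =
      2 * ∑ p ∈ S, 1 / (p : ℝ) + Real.sqrt 2 / 2 * (∑ p ∈ S, 1 / (p : ℝ) +
        ∑ p ∈ S, (1 + (b p * (starRingEnd ℂ) (c p)).re) / (p : ℝ)) := by
    rw [← Finset.sum_add_distrib, Finset.mul_sum, Finset.mul_sum, ← Finset.sum_add_distrib]
    exact Finset.sum_congr rfl fun p _ => by ring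
  rw [e1, e2] at key
  linarith

lemma sum_one_add_re_le_primitive {q d : ℕ} [NeZero d] (χ : DirichletCharacter ℂ q)
    (ψ : DirichletCharacter ℂ d) (y : ℝ) :
    ∑ p ∈ primesUpTo y, (1 + (χ (p : ZMod q) * (starRingEnd ℂ) (ψ (p : ZMod d))).re) / (p : ℝ) ≤
      ∑ p ∈ primesUpTo y, (1 + (χ (p : ZMod q) *
        (starRingEnd ℂ) (ψ.primitiveCharacter (p : ZMod ψ.conductor))).re) / (p : ℝ) +
      ∑ p ∈ d.primeFactors, 1 / (p : ℝ) := by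
  have hpt : ∀ p ∈ primesUpTo y,
      (1 + (χ (p : ZMod q) * (starRingEnd ℂ) (ψ (p : ZMod d))).re) / (p : ℝ) ≤
      (1 + (χ (p : ZMod q) *
        (starRingEnd ℂ) (ψ.primitiveCharacter (p : ZMod ψ.conductor))).re) / (p : ℝ) +
      if p ∈ d.primeFactors then 1 / (p : ℝ) else 0 := by
    intro p hp
    have hpp := prime_of_mem_primesUpTo hp
    by_cases hpd : p ∣ d
    · rw [if_pos (Nat.mem_primeFactors.2 ⟨hpp, hpd, NeZero.ne d⟩),
        char_apply_eq_zero_of_not_coprime ψ (by rwa [hpp.coprime_iff_not_dvd, not_not]),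
        map_zero, mul_zero, Complex.zero_re, add_zero, le_add_iff_nonneg_left]
      have h1 : ‖χ (p : ZMod q) *
          (starRingEnd ℂ) (ψ.primitiveCharacter (p : ZMod ψ.conductor))‖ ≤ 1 := by
        rw [norm_mul, Complex.norm_conj]
        exact mul_le_one₀ (χ.norm_le_one _) (norm_nonneg _) (DirichletCharacter.norm_le_one _ _)
      have h2 := (abs_le.1 ((Complex.abs_re_le_norm _).trans h1)).1
      exact div_nonneg (by linarith) (Nat.cast_nonneg p)
    · rw [if_neg fun h => hpd (Nat.dvd_of_mem_primeFactors h), add_zero]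
      have h := changeLevel_apply_of_coprime ψ.primitiveCharacter ψ.conductor_dvd_level
        ((hpp.coprime_iff_not_dvd).2 hpd)
      rw [DirichletCharacter.changeLevel_primitiveCharacter] at h
      rw [h]
  refine (Finset.sum_le_sum hpt).trans ?_
  rw [Finset.sum_add_distrib]
  gcongr
  rw [← Finset.sum_filter]
  exact Finset.sum_le_sum_of_subset_of_nonneg (fun p hp => (Finset.mem_filter.1 hp).2)
    (fun _ _ _ => by positivity)

lemma sum_le_of_Ddist_le {q a b : ℕ} {χ : DirichletCharacter ℂ q} {ξ : DirichletCharacter ℂ a}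
    {η : DirichletCharacter ℂ b} {y : ℝ} (h : Ddist χ ξ y ≤ Ddist χ η y) :
    ∑ p ∈ primesUpTo y, (1 - (χ (p : ZMod q) * (starRingEnd ℂ) (ξ (p : ZMod a))).re) / (p : ℝ) ≤
      ∑ p ∈ primesUpTo y, (1 - (χ (p : ZMod q) * (starRingEnd ℂ) (η (p : ZMod b))).re) / (p : ℝ) := by
  refine (Real.sqrt_le_sqrt_iff (Finset.sum_nonneg fun p _ => ?_)).1 h
  refine div_nonneg (sub_nonneg.2 ((Complex.re_le_norm _).trans ?_)) (Nat.cast_nonneg p)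
  rw [norm_mul, Complex.norm_conj]
  exact mul_le_one₀ (χ.norm_le_one _) (norm_nonneg _) (η.norm_le_one _)

lemma half_sum_one_add_re_le {q D d : ℕ} [NeZero d] {χ : DirichletCharacter ℂ q}
    {ξ : DirichletCharacter ℂ D} (hξ : ξ.IsPrimitive) {ψ : DirichletCharacter ℂ d}
    (hψ : ¬ ∃ h : D ∣ d, ψ = DirichletCharacter.changeLevel h ξ) {y : ℝ} (hy : 2 ≤ y)
    (hly : 2 ≤ Real.log y) (hD : (D : ℝ) ≤ Real.log y) (hc : (ψ.conductor : ℝ) ≤ Real.log y)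
    (hd : (d : ℝ) ≤ y) (hmin : Ddist χ ξ y ≤ Ddist χ ψ.primitiveCharacter y) :
    1 / 2 * ∑ p ∈ primesUpTo y,
      (1 + (χ (p : ZMod q) * (starRingEnd ℂ) (ψ (p : ZMod d))).re) / (p : ℝ) ≤
      (1 / 2 + Real.sqrt 2 / 4) * Real.log (Real.log y) +
        Real.log (3 + 2 * Real.log (Real.log y)) + 50 := by
  have h1 := sum_one_add_re_le_primitive χ ψ y
  have h2 := sum_one_add_re_le_of_closer (S := primesUpTo y) (a := fun n => χ (n : ZMod q))
    (b := fun n => ξ (n : ZMod D)) (c := fun n => ψ.primitiveCharacter (n : ZMod ψ.conductor))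
    (fun n => χ.norm_le_one _) (fun n => ξ.norm_le_one _)
    (fun n => DirichletCharacter.norm_le_one _ _) (sum_le_of_Ddist_le hmin)
  have h3 := sum_one_add_re_mul_conj_le hξ hψ hy (by linarith) hD hc
  have hd0 : (0 : ℝ) < d := by exact_mod_cast NeZero.pos d
  have h4 := sum_primeFactors_one_div_le (NeZero.ne d) hly (Real.log_le_log hd0 hd)
  have h5 := sum_primesUpTo_one_div_le hy
  have hll : 0 ≤ Real.log (Real.log y) := Real.log_nonneg (by linarith)
  have h6 : Real.log (1 + Real.log y) ≤ Real.log (Real.log y) + 1 := by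
    have hlpos : 0 < Real.log y := by linarith
    calc Real.log (1 + Real.log y) ≤ Real.log (Real.log y * 2) :=
          Real.log_le_log (by linarith) (by linarith)
      _ = Real.log (Real.log y) + Real.log 2 := Real.log_mul hlpos.ne' two_ne_zero
      _ ≤ _ := by linarith [Real.log_two_lt_d9]
  have h7 : Real.log (1 + Real.log (Real.log y)) ≤ Real.log (3 + 2 * Real.log (Real.log y)) :=
    Real.log_le_log (by linarith) (by linarith)
  have h8 : 0 ≤ Real.log (3 + 2 * Real.log (Real.log y)) := Real.log_nonneg (by linarith)
  have hs0 : 0 ≤ Real.sqrt 2 := Real.sqrt_nonneg _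
  have hs : Real.sqrt 2 ≤ 2 := by
    rw [Real.sqrt_le_left (by norm_num)]; norm_num
  have h9 := mul_le_mul_of_nonneg_left (add_le_add h5 h3) (by positivity : 0 ≤ Real.sqrt 2 / 4)
  have h10 : Real.sqrt 2 / 4 * (Real.log (1 + Real.log y) + 21 + (Real.log (1 + Real.log y) +
      Real.log (3 + 2 * Real.log (Real.log y)) + 22)) ≤ Real.sqrt 2 / 2 * Real.log (Real.log y) +
      1 / 2 * (45 + Real.log (3 + 2 * Real.log (Real.log y))) := by
    nlinarith
  linarith

end Repulsion

section SmoothSums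

/-- The completely multiplicative function `χ · conj ψ` restricted to `y`-smooth integers. -/
noncomputable def smoothTwist {q d : ℕ} (χ : DirichletCharacter ℂ q) (ψ : DirichletCharacter ℂ d)
    (y : ℝ) : ℕ →*₀ ℂ where
  toFun n := if ∀ p : ℕ, p.Prime → p ∣ n → (p : ℝ) ≤ y then
    χ (n : ZMod q) * (starRingEnd ℂ) (ψ (n : ZMod d)) else 0
  map_zero' := by
    obtain ⟨p, hp, hpp⟩ := Nat.exists_infinite_primes (⌊y⌋₊ + 1)
    exact if_neg fun h => absurd (Nat.le_floor (h p hpp (dvd_zero p))) (by omega)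
  map_one' := by
    rw [if_pos fun p hp h => absurd (Nat.dvd_one.1 h) hp.ne_one]
    simp
  map_mul' a b := by
    have h : (∀ p : ℕ, p.Prime → p ∣ a * b → (p : ℝ) ≤ y) ↔
        (∀ p : ℕ, p.Prime → p ∣ a → (p : ℝ) ≤ y) ∧ (∀ p : ℕ, p.Prime → p ∣ b → (p : ℝ) ≤ y) := by
      refine ⟨fun h => ⟨fun p hp hd => h p hp (hd.mul_right b), fun p hp hd => h p hp (hd.mul_left a)⟩,
        fun h p hp hd => ?_⟩
      exact (hp.dvd_mul.1 hd).elim (h.1 p hp) (h.2 p hp)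
    rw [if_congr h rfl rfl, ite_and]
    split_ifs
    · simp only [Nat.cast_mul, map_mul]; ring
    all_goals simp

lemma smoothTwist_apply {q d : ℕ} (χ : DirichletCharacter ℂ q) (ψ : DirichletCharacter ℂ d)
    (y : ℝ) (n : ℕ) : smoothTwist χ ψ y n = if ∀ p : ℕ, p.Prime → p ∣ n → (p : ℝ) ≤ y then
      χ (n : ZMod q) * (starRingEnd ℂ) (ψ (n : ZMod d)) else 0 := rfl

lemma smoothTwist_prime {q d : ℕ} (χ : DirichletCharacter ℂ q) (ψ : DirichletCharacter ℂ d)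
    (y : ℝ) {p : ℕ} (hp : p.Prime) : smoothTwist χ ψ y p = if (p : ℝ) ≤ y then
      χ (p : ZMod q) * (starRingEnd ℂ) (ψ (p : ZMod d)) else 0 := by
  rw [smoothTwist_apply]
  refine if_congr ⟨fun h => h p hp dvd_rfl, fun h r hr hd => ?_⟩ rfl rfl
  rwa [(Nat.prime_dvd_prime_iff_eq hr hp).1 hd]

lemma norm_char_mul_conj_le {q d : ℕ} (χ : DirichletCharacter ℂ q) (ψ : DirichletCharacter ℂ d)
    (n : ℕ) : ‖χ (n : ZMod q) * (starRingEnd ℂ) (ψ (n : ZMod d))‖ ≤ 1 := by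
  rw [norm_mul, Complex.norm_conj]
  exact mul_le_one₀ (χ.norm_le_one _) (norm_nonneg _) (ψ.norm_le_one _)

lemma norm_smoothTwist_le {q d : ℕ} (χ : DirichletCharacter ℂ q) (ψ : DirichletCharacter ℂ d)
    (y : ℝ) (n : ℕ) : ‖smoothTwist χ ψ y n‖ ≤ 1 := by
  rw [smoothTwist_apply]
  split_ifs
  · exact norm_char_mul_conj_le χ ψ n
  · simp

lemma norm_one_add_le_one_add_half {w : ℂ} (hw : ‖w‖ ≤ 1) : ‖1 + w‖ ≤ 1 + 1 / 2 * (1 + w.re) := by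
  have hre := (abs_le.1 ((Complex.abs_re_le_norm w).trans hw)).1
  refine abs_le_of_sq_le_sq' ?_ (by linarith) |>.2
  have e : ‖1 + w‖ ^ 2 = 1 + ‖w‖ ^ 2 + 2 * w.re := by
    have := Complex.normSq_add 1 w
    simpa [Complex.normSq_eq_norm_sq] using this
  have hw2 : ‖w‖ ^ 2 ≤ 1 := pow_le_one₀ (norm_nonneg _) hw
  rw [e]
  nlinarith [sq_nonneg (1 - w.re)]

lemma sum_norm_one_add_smoothTwist_le {q d : ℕ} (χ : DirichletCharacter ℂ q)
    (ψ : DirichletCharacter ℂ d) (y : ℝ) (x : ℝ) :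
    ∑ p ∈ primesUpTo x, ‖1 + smoothTwist χ ψ y p‖ / (p : ℝ) ≤ ∑ p ∈ primesUpTo x, 1 / (p : ℝ) +
      1 / 2 * ∑ p ∈ primesUpTo y,
        (1 + (χ (p : ZMod q) * (starRingEnd ℂ) (ψ (p : ZMod d))).re) / (p : ℝ) := by
  have hnn (p : ℕ) : 0 ≤ (1 + (χ (p : ZMod q) * (starRingEnd ℂ) (ψ (p : ZMod d))).re) / (p : ℝ) := by
    have := (abs_le.1 ((Complex.abs_re_le_norm _).trans (norm_char_mul_conj_le χ ψ p))).1
    exact div_nonneg (by linarith) (Nat.cast_nonneg p)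
  have hpt : ∀ p ∈ primesUpTo x, ‖1 + smoothTwist χ ψ y p‖ / (p : ℝ) ≤ 1 / (p : ℝ) +
      1 / 2 * if p ∈ primesUpTo y then
        (1 + (χ (p : ZMod q) * (starRingEnd ℂ) (ψ (p : ZMod d))).re) / (p : ℝ) else 0 := by
    intro p hp
    have hpp := prime_of_mem_primesUpTo hp
    rw [smoothTwist_prime χ ψ y hpp]
    by_cases hpy : (p : ℝ) ≤ y
    · have hmem : p ∈ primesUpTo y :=
        Finset.mem_filter.2 ⟨Finset.mem_Icc.2 ⟨hpp.one_le, Nat.le_floor hpy⟩, hpp⟩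
      rw [if_pos hpy, if_pos hmem, ← mul_div_assoc, ← add_div]
      gcongr
      exact norm_one_add_le_one_add_half (norm_char_mul_conj_le χ ψ p)
    · rw [if_neg hpy, add_zero, norm_one, le_add_iff_nonneg_right]
      split_ifs
      · exact mul_nonneg (by norm_num) (hnn p)
      · simp
  refine (Finset.sum_le_sum hpt).trans ?_
  rw [Finset.sum_add_distrib, ← Finset.mul_sum, ← Finset.sum_filter]
  refine add_le_add_right (mul_le_mul_of_nonneg_left ?_ (by norm_num)) _
  exact Finset.sum_le_sum_of_subset_of_nonneg (fun p hp => (Finset.mem_filter.1 hp).2)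
    fun p _ _ => hnn p

lemma norm_sum_smoothTwist_le {q d : ℕ} (χ : DirichletCharacter ℂ q) (ψ : DirichletCharacter ℂ d)
    (y : ℝ) (N : ℕ) :
    ‖∑ n ∈ Finset.Icc 1 N, smoothTwist χ ψ y n / n‖ ≤ 1 + 39 * Real.exp (37 +
      1 / 2 * ∑ p ∈ primesUpTo y,
        (1 + (χ (p : ZMod q) * (starRingEnd ℂ) (ψ (p : ZMod d))).re) / (p : ℝ)) := by
  rcases lt_or_ge N 2 with hN | hN
  · refine le_add_of_le_of_nonneg ?_ (by positivity)
    interval_cases N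
    · simp
    · simp
  · have h := norm_sum_div_le_exp (norm_smoothTwist_le χ ψ y) hN
    have hN2 : (2 : ℝ) ≤ N := by exact_mod_cast hN
    have h1 := sum_norm_one_add_smoothTwist_le χ ψ y N
    have h2 := sum_primesUpTo_one_div_le hN2
    have e : primesUpTo (N : ℝ) = (Finset.Icc 1 N).filter Nat.Prime := by
      rw [primesUpTo, Nat.floor_natCast]
    rw [← e] at h
    refine h.trans ?_
    set A := 1 / 2 * ∑ p ∈ primesUpTo y,
      (1 + (χ (p : ZMod q) * (starRingEnd ℂ) (ψ (p : ZMod d))).re) / (p : ℝ)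
    have hl : Real.log 2 ≤ Real.log N := Real.log_le_log (by norm_num) hN2
    have hl2 := Real.log_two_gt_d9
    have hpos : 0 < Real.log N := by linarith
    have h3 : Real.exp (∑ p ∈ primesUpTo N, ‖1 + smoothTwist χ ψ y p‖ / (p : ℝ) + 16) ≤
        (3 * Real.log N) * Real.exp (37 + A) := by
      calc _ ≤ Real.exp (Real.log (1 + Real.log N) + (37 + A)) := Real.exp_le_exp.2 (by linarith)
        _ = (1 + Real.log N) * Real.exp (37 + A) := by rw [Real.exp_add, Real.exp_log (by linarith)]
        _ ≤ _ := by gcongr; linarith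
    have h4 := mul_le_mul_of_nonneg_left h3 (by positivity : 0 ≤ 13 / Real.log N)
    have h5 : 13 / Real.log N * ((3 * Real.log N) * Real.exp (37 + A)) = 39 * Real.exp (37 + A) := by
      field_simp; norm_num
    linarith

lemma exists_forall_le_exp_mul {ε : ℝ} (hε : 0 < ε) :
    ∃ t₀ : ℝ, 1 ≤ t₀ ∧ ∀ t, t₀ ≤ t → 1 + 39 * Real.exp 87 * (3 + 2 * t) ≤ Real.exp (ε * t) := by
  have h1 : (fun t : ℝ => 1 + 39 * Real.exp 87 * (3 + 2 * t)) =o[Filter.atTop]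
      fun t => Real.exp (ε * t) := by
    have hc (c : ℝ) : (fun _ : ℝ => c) =o[Filter.atTop] fun t => Real.exp (ε * t) := by
      simpa using (isLittleO_pow_exp_pos_mul_atTop 0 hε).const_mul_left c
    have hid : (fun t : ℝ => t) =o[Filter.atTop] fun t => Real.exp (ε * t) := by
      simpa using isLittleO_pow_exp_pos_mul_atTop 1 hε
    exact (hc 1).add (((hc 3).add (hid.const_mul_left 2)).const_mul_left _)
  obtain ⟨t₁, ht₁⟩ := Filter.eventually_atTop.1 (h1.bound one_pos)
  refine ⟨max 1 t₁, le_max_left _ _, fun t ht => ?_⟩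
  have h := ht₁ t ((le_max_right _ _).trans ht)
  rw [one_mul, Real.norm_of_nonneg (Real.exp_pos _).le] at h
  exact (le_abs_self _).trans h

end SmoothSums

/-- Lemma 11: repulsion. -/
theorem repulsion_lemma :
    ∀ ε : ℝ, 0 < ε →
      ∃ y₀ : ℝ, 2 ≤ y₀ ∧
        ∀ y : ℝ, y₀ ≤ y →
          ∀ (q : ℕ) (χ : DirichletCharacter ℂ q) (D : ℕ) (ξ : DirichletCharacter ℂ D),
            ξ.IsPrimitive → (D : ℝ) ≤ Real.log y →
            (∀ (d₁ : ℕ) (ψ₁ : DirichletCharacter ℂ d₁), ψ₁.IsPrimitive →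
              (d₁ : ℝ) ≤ Real.log y → Ddist χ ξ y ≤ Ddist χ ψ₁ y) →
            ∀ (d : ℕ) (ψ : DirichletCharacter ℂ d), (d : ℝ) ≤ y →
              (ψ.conductor : ℝ) ≤ Real.log y →
              (¬ ∃ h : D ∣ d, ψ = DirichletCharacter.changeLevel h ξ) →
              ∀ z : ℝ, 1 ≤ z →
                ‖∑ n ∈ (Finset.Icc 1 ⌊z⌋₊).filter
                    (fun n => ∀ p : ℕ, p.Prime → p ∣ n → (p : ℝ) ≤ y),
                    χ (n : ZMod q) * (starRingEnd ℂ) (ψ (n : ZMod d)) / n‖ ≤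
                  Real.log y ^ ((1 : ℝ) / 2 + Real.sqrt 2 / 4 + ε) := by
  intro ε hε
  obtain ⟨t₀, ht₀, hexp⟩ := exists_forall_le_exp_mul hε
  have hbig : 2 ≤ Real.exp t₀ := by linarith [Real.add_one_le_exp t₀]
  refine ⟨Real.exp (Real.exp t₀), by linarith [Real.add_one_le_exp (Real.exp t₀)], ?_⟩
  intro y hy q χ D ξ hξ hD hmin d ψ hd hc hψ z _
  have hy0 : 0 < y := (Real.exp_pos _).trans_le hy
  have hly : Real.exp t₀ ≤ Real.log y := (Real.le_log_iff_exp_le hy0).2 hy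
  have hlpos : 0 < Real.log y := (Real.exp_pos _).trans_le hly
  have hll : t₀ ≤ Real.log (Real.log y) := (Real.le_log_iff_exp_le hlpos).2 hly
  have hy2 : 2 ≤ y := by linarith [Real.add_one_le_exp (Real.exp t₀)]
  have hs : 0 ≤ Real.sqrt 2 := Real.sqrt_nonneg _
  rcases Nat.eq_zero_or_pos d with rfl | hdpos
  · have hone : ‖∑ n ∈ (Finset.Icc 1 ⌊z⌋₊).filter
        (fun n => ∀ p : ℕ, p.Prime → p ∣ n → (p : ℝ) ≤ y),
        χ (n : ZMod q) * (starRingEnd ℂ) (ψ (n : ZMod 0)) / n‖ ≤ 1 := by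
      refine (norm_sum_le _ _).trans ?_
      have hle : ∀ n ∈ (Finset.Icc 1 ⌊z⌋₊).filter
          (fun n => ∀ p : ℕ, p.Prime → p ∣ n → (p : ℝ) ≤ y),
          ‖χ (n : ZMod q) * (starRingEnd ℂ) (ψ (n : ZMod 0)) / n‖ ≤ if n = 1 then (1 : ℝ) else 0 := by
        intro n _
        split_ifs with hn
        · subst hn
          simp
        · rw [char_apply_eq_zero_of_not_coprime ψ (by rwa [Nat.coprime_zero_right])]
          simp
      refine (Finset.sum_le_sum hle).trans ?_
      rw [Finset.sum_ite_eq']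
      split_ifs <;> norm_num
    exact hone.trans (Real.one_le_rpow (by linarith) (by positivity))
  · have : NeZero d := ⟨hdpos.ne'⟩
    have hA := half_sum_one_add_re_le hξ hψ hy2 (by linarith) hD hc hd
      (hmin _ _ ψ.primitiveCharacter_isPrimitive hc)
    have hN := norm_sum_smoothTwist_le χ ψ y ⌊z⌋₊
    have e : ∑ n ∈ (Finset.Icc 1 ⌊z⌋₊).filter
        (fun n => ∀ p : ℕ, p.Prime → p ∣ n → (p : ℝ) ≤ y),
        χ (n : ZMod q) * (starRingEnd ℂ) (ψ (n : ZMod d)) / n =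
        ∑ n ∈ Finset.Icc 1 ⌊z⌋₊, smoothTwist χ ψ y n / n := by
      rw [Finset.sum_filter]
      refine Finset.sum_congr rfl fun n _ => ?_
      rw [smoothTwist_apply]
      split_ifs <;> simp
    rw [e]
    refine hN.trans ?_
    set t := Real.log (Real.log y) with ht
    set κ := 1 / 2 + Real.sqrt 2 / 4 with hκ
    have hκ0 : 0 ≤ κ := by positivity
    have ht0 : 0 ≤ t := by linarith
    have h1 : Real.exp (37 + 1 / 2 * ∑ p ∈ primesUpTo y,
        (1 + (χ (p : ZMod q) * (starRingEnd ℂ) (ψ (p : ZMod d))).re) / (p : ℝ)) ≤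
        Real.exp (κ * t) * (3 + 2 * t) * Real.exp 87 := by
      calc _ ≤ Real.exp (κ * t + Real.log (3 + 2 * t) + 87) := Real.exp_le_exp.2 (by linarith)
        _ = _ := by rw [Real.exp_add, Real.exp_add, Real.exp_log (by linarith)]
    have h2 : (1 : ℝ) ≤ Real.exp (κ * t) := Real.one_le_exp (by positivity)
    rw [Real.rpow_def_of_pos hlpos, ← ht, mul_add t κ ε, Real.exp_add (t * κ), mul_comm t κ, mul_comm t ε]
    calc _ ≤ Real.exp (κ * t) + 39 * (Real.exp (κ * t) * (3 + 2 * t) * Real.exp 87) := by linarith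
      _ = Real.exp (κ * t) * (1 + 39 * Real.exp 87 * (3 + 2 * t)) := by ring
      _ ≤ _ := by gcongr; exact hexp t hll
end

section
/- There is an absolute constant C > 0 such that for every completely multiplicative function f : ℕ → ℂ with |f(n)| ≤ 1 for all n, every positive integer a, and every real z ≥ 1, one has both |∑_{n ≤ z} f(n)/n − ∏_{p ∣ a}(1 − f(p)/p)^{−1}·∑_{n ≤ z, gcd(n,a) = 1} f(n)/n| ≤ C·(a/φ(a))·∑_{p ∣ a, p prime} (log p)/p and |∑_{n ≤ z, gcd(n,a) = 1} f(n)/n − ∏_{p ∣ a}(1 − f(p)/p)·∑_{n ≤ z} f(n)/n| ≤ C·(a/φ(a))·∑_{p ∣ a, p prime} (log p)/p, where the products are over the distinct prime divisors p of a. -/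
open Real Complex MeasureTheory
open scoped BigOperators

attribute [local instance] Classical.propDecidable

/-- `∑ f(n)/n` over the `n ≤ N` divisible by no element of `S`. -/
noncomputable def siftedSum (f : ℕ → ℂ) (S : Finset ℕ) (N : ℕ) : ℂ :=
  ∑ n ∈ (Finset.Icc 1 N).filter (fun n => ∀ p ∈ S, ¬ p ∣ n), f n / n

lemma norm_div_natCast_le {f : ℕ → ℂ} (hf : ∀ n, ‖f n‖ ≤ 1) (n : ℕ) :
    ‖f n / (n : ℂ)‖ ≤ (n : ℝ)⁻¹ := by
  rw [norm_div, Complex.norm_natCast, div_eq_mul_inv]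
  exact mul_le_of_le_one_left (by positivity) (hf n)

lemma sum_Ioc_div_inv_le {q : ℕ} (hq : 2 ≤ q) (N : ℕ) :
    ∑ n ∈ Finset.Ioc (N / q) N, (n : ℝ)⁻¹ ≤ 3 * Real.log q := by
  have hq' : (2 : ℝ) ≤ q := by exact_mod_cast hq
  have hlog : 1 ≤ 2 * Real.log q := by
    have := Real.log_le_log (by norm_num) hq'
    linarith [Real.log_two_gt_d9]
  rcases Nat.eq_zero_or_pos N with rfl | hN
  · simp; linarith
  have hsplit : ∑ n ∈ Finset.Icc 1 (N / q), (n : ℝ)⁻¹ + ∑ n ∈ Finset.Ioc (N / q) N, (n : ℝ)⁻¹ =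
      ∑ n ∈ Finset.Icc 1 N, (n : ℝ)⁻¹ := by
    rw [← Finset.sum_union]
    · congr 1
      have := Nat.div_le_self N q
      ext n
      simp only [Finset.mem_union, Finset.mem_Icc, Finset.mem_Ioc]
      generalize N / q = M at *
      omega
    · rw [Finset.disjoint_left]
      intro n
      simp only [Finset.mem_Icc, Finset.mem_Ioc]
      omega
  have hup := harmonic_le_one_add_log N
  have hlo := log_add_one_le_harmonic (N / q)
  simp only [harmonic_eq_sum_Icc, Rat.cast_sum, Rat.cast_inv, Rat.cast_natCast] at hup hlo
  have hlt : (N : ℝ) ≤ q * (((N / q : ℕ) + 1 : ℕ) : ℝ) := by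
    exact_mod_cast (Nat.lt_mul_div_succ N (by omega : 0 < q)).le
  have hle := Real.log_le_log (by exact_mod_cast hN) hlt
  rw [Real.log_mul (by positivity) (by positivity)] at hle
  push_cast at hle hlo
  linarith

lemma siftedSum_insert {f : ℕ → ℂ} (hmul : ∀ m n : ℕ, f (m * n) = f m * f n) {S : Finset ℕ}
    (hS : ∀ p ∈ S, p.Prime) {q : ℕ} (hq : q.Prime) (hqS : q ∉ S) (N : ℕ) :
    siftedSum f S N = siftedSum f (insert q S) N + f q / q * siftedSum f S (N / q) := by
  unfold siftedSum
  rw [← Finset.sum_filter_not_add_sum_filter (s := Finset.filter _ _) (p := fun n => q ∣ n)]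
  congr 1
  · refine Finset.sum_congr ?_ fun _ _ => rfl
    ext n
    simp only [Finset.mem_filter, Finset.mem_insert, forall_eq_or_imp]
    tauto
  · rw [Finset.mul_sum]
    symm
    refine Finset.sum_nbij (fun m => q * m) ?_ ?_ ?_ ?_
    · intro m hm
      simp only [Finset.mem_filter, Finset.mem_Icc] at hm ⊢
      obtain ⟨⟨h1, h2⟩, h3⟩ := hm
      refine ⟨⟨⟨Nat.mul_pos hq.pos h1, ?_⟩, ?_⟩, dvd_mul_right q m⟩
      · exact (Nat.mul_le_mul_left q h2).trans (Nat.mul_div_le N q)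
      · intro p hp hd
        rcases (hS p hp).dvd_mul.1 hd with h | h
        · exact hqS (((Nat.prime_dvd_prime_iff_eq (hS p hp) hq).1 h) ▸ hp)
        · exact h3 p hp h
    · intro m _ n _ h
      exact Nat.eq_of_mul_eq_mul_left hq.pos h
    · intro n hn
      simp only [Finset.coe_filter, Finset.mem_filter, Finset.mem_Icc, Set.mem_ofPred_eq] at hn
      obtain ⟨⟨⟨h1, h2⟩, h3⟩, m, rfl⟩ := hn
      refine ⟨m, ?_, rfl⟩
      simp only [Finset.coe_filter, Finset.mem_Icc, Set.mem_ofPred_eq]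
      refine ⟨⟨Nat.pos_of_mul_pos_left h1, ?_⟩, fun p hp hd => h3 p hp (hd.mul_left q)⟩
      exact (Nat.le_div_iff_mul_le hq.pos).2 (by rwa [mul_comm])
    · intro m _
      rw [hmul]
      push_cast
      ring

lemma norm_siftedSum_sub_siftedSum_div_le {f : ℕ → ℂ} (hf : ∀ n, ‖f n‖ ≤ 1) (S : Finset ℕ)
    {q : ℕ} (hq : 2 ≤ q) (N : ℕ) :
    ‖siftedSum f S N - siftedSum f S (N / q)‖ ≤ 3 * Real.log q := by
  have hsub : (Finset.Icc 1 (N / q)).filter (fun n => ∀ p ∈ S, ¬ p ∣ n) ⊆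
      (Finset.Icc 1 N).filter (fun n => ∀ p ∈ S, ¬ p ∣ n) :=
    Finset.filter_subset_filter _ (Finset.Icc_subset_Icc_right (Nat.div_le_self N q))
  unfold siftedSum
  rw [← Finset.sum_sdiff hsub, add_sub_cancel_right]
  refine le_trans ?_ (sum_Ioc_div_inv_le hq N)
  refine (norm_sum_le _ _).trans ?_
  refine (Finset.sum_le_sum (g := fun n : ℕ => (n : ℝ)⁻¹) fun n _ => ?_).trans
    (Finset.sum_le_sum_of_subset_of_nonneg ?_ fun _ _ _ => by positivity)
  · exact norm_div_natCast_le hf n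
  · intro n
    simp only [Finset.mem_sdiff, Finset.mem_filter, Finset.mem_Icc, Finset.mem_Ioc]
    rintro ⟨⟨⟨h1, h2⟩, h3⟩, h4⟩
    refine ⟨?_, h2⟩
    by_contra! h
    exact h4 ⟨⟨h1, h⟩, h3⟩

lemma norm_siftedSum_insert_sub_le {f : ℕ → ℂ} (hmul : ∀ m n : ℕ, f (m * n) = f m * f n)
    (hf : ∀ n, ‖f n‖ ≤ 1) {S : Finset ℕ} (hS : ∀ p ∈ S, p.Prime) {q : ℕ} (hq : q.Prime)
    (hqS : q ∉ S) (N : ℕ) :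
    ‖siftedSum f (insert q S) N - (1 - f q / q) * siftedSum f S N‖ ≤ 3 * (Real.log q / q) := by
  have key : siftedSum f (insert q S) N - (1 - f q / q) * siftedSum f S N =
      f q / q * (siftedSum f S N - siftedSum f S (N / q)) := by
    linear_combination -siftedSum_insert hmul hS hq hqS N
  rw [key, norm_mul]
  calc _ ≤ (q : ℝ)⁻¹ * (3 * Real.log q) :=
        mul_le_mul (norm_div_natCast_le hf q)
          (norm_siftedSum_sub_siftedSum_div_le hf S hq.two_le N) (norm_nonneg _)
          (by positivity)
    _ = _ := by ring

lemma norm_one_sub_div_inv_le {f : ℕ → ℂ} (hf : ∀ n, ‖f n‖ ≤ 1) {q : ℕ} (hq : 2 ≤ q) :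
    ‖(1 - f q / q)⁻¹‖ ≤ (1 - (q : ℝ)⁻¹)⁻¹ := by
  have hq' : (2 : ℝ) ≤ q := by exact_mod_cast hq
  have hx := norm_div_natCast_le hf q
  have hinv : (q : ℝ)⁻¹ < 1 := inv_lt_one_of_one_lt₀ (by linarith)
  have htri := norm_sub_norm_le (1 : ℂ) (f q / q)
  rw [norm_one] at htri
  rw [norm_inv]
  exact inv_anti₀ (by linarith) (by linarith)

lemma one_sub_div_ne_zero {f : ℕ → ℂ} (hf : ∀ n, ‖f n‖ ≤ 1) {q : ℕ} (hq : 2 ≤ q) :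
    1 - f q / (q : ℂ) ≠ 0 := by
  have hq' : (2 : ℝ) ≤ q := by exact_mod_cast hq
  intro h
  have h1 : ‖f q / (q : ℂ)‖ = 1 := by rw [← sub_eq_zero.1 h, norm_one]
  rw [norm_div, Complex.norm_natCast, div_eq_one_iff_eq (by positivity)] at h1
  linarith [hf q]

lemma one_le_one_sub_inv_inv {q : ℕ} (hq : 2 ≤ q) : (1 : ℝ) ≤ (1 - (q : ℝ)⁻¹)⁻¹ := by
  have hq' : (2 : ℝ) ≤ q := by exact_mod_cast hq
  have hinv : (q : ℝ)⁻¹ < 1 := inv_lt_one_of_one_lt₀ (by linarith)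
  exact (one_le_inv₀ (by linarith)).2 (sub_le_self _ (by positivity))

lemma norm_one_sub_div_le {f : ℕ → ℂ} (hf : ∀ n, ‖f n‖ ≤ 1) {q : ℕ} (hq : 2 ≤ q) :
    ‖1 - f q / (q : ℂ)‖ ≤ (1 - (q : ℝ)⁻¹)⁻¹ := by
  have hq' : (2 : ℝ) ≤ q := by exact_mod_cast hq
  have hx := norm_div_natCast_le hf q
  have hinv : (q : ℝ)⁻¹ < 1 := inv_lt_one_of_one_lt₀ (by linarith)
  have htri := norm_sub_le (1 : ℂ) (f q / q)
  rw [norm_one] at htri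
  refine (htri.trans (add_le_add_right hx 1)).trans ?_
  rw [inv_eq_one_div (1 - (q : ℝ)⁻¹), le_div_iff₀ (by linarith)]
  nlinarith [sq_nonneg (q : ℝ)⁻¹]

lemma one_le_prod_one_sub_inv_inv {S : Finset ℕ} (hS : ∀ p ∈ S, p.Prime) :
    (1 : ℝ) ≤ ∏ p ∈ S, (1 - (p : ℝ)⁻¹)⁻¹ := by
  simpa using Finset.prod_le_prod (f := fun _ => (1 : ℝ)) (fun _ _ => zero_le_one)
    fun p hp => one_le_one_sub_inv_inv (hS p hp).two_le

lemma norm_siftedSum_sub_prod_mul_le {f : ℕ → ℂ} (hmul : ∀ m n : ℕ, f (m * n) = f m * f n)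
    (hf : ∀ n, ‖f n‖ ≤ 1) (N : ℕ) (S : Finset ℕ) (hS : ∀ p ∈ S, p.Prime) :
    ‖siftedSum f S N - (∏ p ∈ S, (1 - f p / p)) * siftedSum f ∅ N‖ ≤
      3 * (∏ p ∈ S, (1 - (p : ℝ)⁻¹)⁻¹) * ∑ p ∈ S, Real.log p / p := by
  induction S using Finset.induction_on with
  | empty => simp
  | insert q S hqS ih =>
    rw [Finset.forall_mem_insert] at hS
    obtain ⟨hq, hS⟩ := hS
    specialize ih hS
    have hE := norm_siftedSum_insert_sub_le hmul hf hS hq hqS N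
    have hB := norm_one_sub_div_le hf hq.two_le
    have hB1 := one_le_one_sub_inv_inv hq.two_le
    have hP1 := one_le_prod_one_sub_inv_inv hS
    have hL : 0 ≤ Real.log q / q := div_nonneg (Real.log_natCast_nonneg q) (by positivity)
    rw [Finset.prod_insert hqS, Finset.prod_insert hqS, Finset.sum_insert hqS]
    set B := (1 - (q : ℝ)⁻¹)⁻¹
    set P := ∏ p ∈ S, (1 - (p : ℝ)⁻¹)⁻¹
    set L := Real.log q / q
    set T := ∑ p ∈ S, Real.log p / p
    calc _ = ‖(siftedSum f (insert q S) N - (1 - f q / q) * siftedSum f S N) +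
          (1 - f q / q) * (siftedSum f S N - (∏ p ∈ S, (1 - f p / p)) * siftedSum f ∅ N)‖ := by
          congr 1; ring
      _ ≤ 3 * L + B * (3 * P * T) := by
          refine (norm_add_le _ _).trans (add_le_add hE ?_)
          rw [norm_mul]
          exact mul_le_mul hB ih (norm_nonneg _) (by linarith)
      _ ≤ 3 * (B * P) * (L + T) := by
          nlinarith [mul_le_mul_of_nonneg_right (one_le_mul_of_one_le_of_one_le hB1 hP1) hL]

lemma norm_siftedSum_empty_sub_prod_inv_mul_le {f : ℕ → ℂ}
    (hmul : ∀ m n : ℕ, f (m * n) = f m * f n) (hf : ∀ n, ‖f n‖ ≤ 1) (N : ℕ) (S : Finset ℕ)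
    (hS : ∀ p ∈ S, p.Prime) :
    ‖siftedSum f ∅ N - (∏ p ∈ S, (1 - f p / p)⁻¹) * siftedSum f S N‖ ≤
      3 * (∏ p ∈ S, (1 - (p : ℝ)⁻¹)⁻¹) * ∑ p ∈ S, Real.log p / p := by
  induction S using Finset.induction_on with
  | empty => simp
  | insert q S hqS ih =>
    rw [Finset.forall_mem_insert] at hS
    obtain ⟨hq, hS⟩ := hS
    specialize ih hS
    have hE := norm_siftedSum_insert_sub_le hmul hf hS hq hqS N
    have hB := norm_one_sub_div_inv_le hf hq.two_le
    have hB1 := one_le_one_sub_inv_inv hq.two_le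
    have hP1 := one_le_prod_one_sub_inv_inv hS
    have hP : ‖∏ p ∈ S, (1 - f p / (p : ℂ))⁻¹‖ ≤ ∏ p ∈ S, (1 - (p : ℝ)⁻¹)⁻¹ := by
      rw [norm_prod]
      exact Finset.prod_le_prod (fun _ _ => norm_nonneg _)
        fun p hp => norm_one_sub_div_inv_le hf (hS p hp).two_le
    have hne := one_sub_div_ne_zero hf hq.two_le
    have hT : 0 ≤ ∑ p ∈ S, Real.log p / p :=
      Finset.sum_nonneg fun p _ => div_nonneg (Real.log_natCast_nonneg p) (by positivity)
    rw [Finset.prod_insert hqS, Finset.prod_insert hqS, Finset.sum_insert hqS]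
    set B := (1 - (q : ℝ)⁻¹)⁻¹
    set P := ∏ p ∈ S, (1 - (p : ℝ)⁻¹)⁻¹
    set L := Real.log q / q
    set T := ∑ p ∈ S, Real.log p / p
    set Q := ∏ p ∈ S, (1 - f p / (p : ℂ))⁻¹
    calc _ = ‖(siftedSum f ∅ N - Q * siftedSum f S N) - (1 - f q / q)⁻¹ * Q *
          (siftedSum f (insert q S) N - (1 - f q / q) * siftedSum f S N)‖ := by
          congr 1
          linear_combination (-Q * siftedSum f S N) * inv_mul_cancel₀ hne
      _ ≤ 3 * P * T + B * P * (3 * L) := by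
          refine (norm_sub_le _ _).trans (add_le_add ih ?_)
          rw [norm_mul, norm_mul]
          gcongr
      _ ≤ 3 * (B * P) * (L + T) := by
          nlinarith [mul_le_mul_of_nonneg_right hB1 (mul_nonneg (zero_le_one.trans hP1) hT)]

lemma div_totient_eq_prod {a : ℕ} (ha : 0 < a) :
    (a : ℝ) / a.totient = ∏ p ∈ a.primeFactors, (1 - (p : ℝ)⁻¹)⁻¹ := by
  have h : (a.totient : ℝ) = a * ∏ p ∈ a.primeFactors, (1 - (p : ℝ)⁻¹) := by
    have := congrArg (Rat.cast : ℚ → ℝ) (Nat.totient_eq_mul_prod_factors a)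
    push_cast at this
    exact this
  rw [h, Finset.prod_inv_distrib, div_mul_eq_div_div, div_self (by positivity), one_div]

lemma siftedSum_primeFactors (f : ℕ → ℂ) {a : ℕ} (ha : 0 < a) (N : ℕ) :
    siftedSum f a.primeFactors N =
      ∑ n ∈ (Finset.Icc 1 N).filter (fun n => n.Coprime a), f n / n := by
  refine Finset.sum_congr (Finset.filter_congr fun n _ => ?_) fun _ _ => rfl
  rw [← not_iff_not, Nat.Prime.not_coprime_iff_dvd]
  simp only [Nat.mem_primeFactors, not_forall, not_not, exists_prop]
  exact exists_congr fun p => by have := ha.ne'; tauto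

/-- Lemma 13: removing/inserting a coprimality condition. -/
theorem change_gcd_lemma :
    ∃ C : ℝ, 0 < C ∧
      ∀ f : ℕ → ℂ, f 1 = 1 → (∀ m n : ℕ, f (m * n) = f m * f n) → (∀ n, ‖f n‖ ≤ 1) →
        ∀ a : ℕ, 0 < a → ∀ z : ℝ, 1 ≤ z →
          ‖(∑ n ∈ Finset.Icc 1 ⌊z⌋₊, f n / n) -
              (∏ p ∈ a.primeFactors, (1 - f p / p)⁻¹) *
                ∑ n ∈ (Finset.Icc 1 ⌊z⌋₊).filter (fun n => n.Coprime a), f n / n‖ ≤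
            C * ((a : ℝ) / a.totient) * ∑ p ∈ a.primeFactors, Real.log p / p ∧
          ‖(∑ n ∈ (Finset.Icc 1 ⌊z⌋₊).filter (fun n => n.Coprime a), f n / n) -
              (∏ p ∈ a.primeFactors, (1 - f p / p)) * ∑ n ∈ Finset.Icc 1 ⌊z⌋₊, f n / n‖ ≤
            C * ((a : ℝ) / a.totient) * ∑ p ∈ a.primeFactors, Real.log p / p := by
  refine ⟨3, by norm_num, fun f _ hmul hf a ha z _ => ?_⟩
  have hprime : ∀ p ∈ a.primeFactors, p.Prime := fun p => Nat.prime_of_mem_primeFactors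
  have hempty : siftedSum f ∅ ⌊z⌋₊ = ∑ n ∈ Finset.Icc 1 ⌊z⌋₊, f n / n := by
    simp [siftedSum]
  rw [div_totient_eq_prod ha, ← siftedSum_primeFactors f ha, ← hempty]
  exact ⟨norm_siftedSum_empty_sub_prod_inv_mul_le hmul hf _ _ hprime,
    norm_siftedSum_sub_prod_mul_le hmul hf _ _ hprime⟩
end
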